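/- Let n ≥ 2 and 2 < p < ∞, and let B_p^n be the unit ball of ℓ_p^n. Then lim_{δ→0} (d_p(δ) − 1)/δ^{2/(n+1)} = G((n^{−1/p},…,n^{−1/p})) = G_max, where G = G_{B_p^n}, G_max = max_{x∈∂B_p^n} G(x), and G_min = min_{x∈∂B_p^n} G(x) = 0, so the limit equals G_max − G_min. -/

import Mathlib

open MeasureTheory Metric Set Filter
open scoped RealInnerProductSpace Pointwise Topology

noncomputable section

abbrev Euc (n : ℕ) : Type := EuclideanSpace ℝ (Fin n)

/-- A centrally symmetric convex body in `ℝⁿ`. -/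
def IsSymConvexBody {n : ℕ} (S : Set (Euc n)) : Prop :=
  IsCompact S ∧ Convex ℝ S ∧ (interior S).Nonempty ∧ S = -S

/-- The convex floating body `K_δ`: the intersection of all closed halfspaces whose bounding
hyperplane cuts off a set of volume at most `δ·|K|ₙ` from `K`. -/
def floatingBody {n : ℕ} (K : Set (Euc n)) (δ : ℝ) : Set (Euc n) :=
  ⋂ (v : Euc n) (_ : v ≠ 0) (c : ℝ)
    (_ : volume (K ∩ {y | c ≤ ⟪v, y⟫}) ≤ ENNReal.ofReal δ * volume K),
    {y | ⟪v, y⟫ ≤ c}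

/-- The illumination body `K^δ`. -/
def illuminationBody {n : ℕ} (K : Set (Euc n)) (δ : ℝ) : Set (Euc n) :=
  {x | volume (convexHull ℝ (K ∪ {x})) ≤ ENNReal.ofReal (1 + δ) * volume K}

/-- The polar body `K°`. -/
def polarBody {n : ℕ} (K : Set (Euc n)) : Set (Euc n) :=
  {y | ∀ x ∈ K, ⟪x, y⟫ ≤ 1}

/-- The distance `d(C₁, C₂) = inf {a ≥ 1 : a⁻¹ C₁ ⊆ C₂ ⊆ a C₁}`. -/
def bodyDist {n : ℕ} (C₁ C₂ : Set (Euc n)) : ℝ :=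
  sInf {a : ℝ | 1 ≤ a ∧ a⁻¹ • C₁ ⊆ C₂ ∧ C₂ ⊆ a • C₁}

/-- `d_C(δ) = inf_{δ' > 0} d(C_δ, ((C°)^{δ'})°)`. -/
def dualDist {n : ℕ} (C : Set (Euc n)) (δ : ℝ) : ℝ :=
  sInf {r : ℝ | ∃ δ' > (0:ℝ), r = bodyDist (floatingBody C δ)
      (polarBody (illuminationBody (polarBody C) δ'))}

/-- `ν` is an outer unit normal of `S` at `x`. -/
def IsOuterNormalAt {n : ℕ} (S : Set (Euc n)) (x ν : Euc n) : Prop :=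
  ‖ν‖ = 1 ∧ ∀ y ∈ S, ⟪y, ν⟫ ≤ ⟪x, ν⟫

/-- Near `x ∈ ∂S`, the boundary of `S` is the graph of a `C²` function `f` over the tangent
hyperplane at `x` (embedded via a linear isometry `L` orthogonal to the normal `ν`), with
`f 0 = 0` and vanishing derivative at `0`, and `k` is the determinant of the Hessian of `f`
at `0`, i.e. the Gauss curvature of `∂S` at `x`. -/
def IsGaussCurvatureAt {n : ℕ} (S : Set (Euc n)) (x ν : Euc n) (k : ℝ) : Prop :=
  ∃ (L : Euc (n-1) →ₗᵢ[ℝ] Euc n) (f : Euc (n-1) → ℝ) (τ ε : ℝ),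
    0 < τ ∧ 0 < ε ∧
    (∀ v, ⟪L v, ν⟫ = 0) ∧
    ContDiffOn ℝ 2 f (ball 0 τ) ∧
    f 0 = 0 ∧ fderiv ℝ f 0 = 0 ∧
    frontier S ∩ ball x ε
      = {y | ∃ v ∈ ball (0 : Euc (n-1)) τ, y = x + L v - f v • ν} ∩ ball x ε ∧
    k = (Matrix.of fun i j : Fin (n-1) =>
      iteratedFDeriv ℝ 2 f 0 ![EuclideanSpace.single i 1, EuclideanSpace.single j 1]).det

/-- `S` has `C²` boundary, with outer unit normal map `u` and Gauss curvature function `κ`. -/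
def IsC2Body {n : ℕ} (S : Set (Euc n)) (u : Euc n → Euc n) (κ : Euc n → ℝ) : Prop :=
  ∀ x ∈ frontier S, IsOuterNormalAt S x (u x) ∧ IsGaussCurvatureAt S x (u x) (κ x)

/-- The constant `c(K, n) = ((n+1)^{2/(n+1)}/2)·(|K|ₙ/|B₂^{n−1}|_{n−1})^{2/(n+1)}`. -/
def cConst (n : ℕ) (K : Set (Euc n)) : ℝ :=
  ((n + 1 : ℝ) ^ ((2:ℝ)/(n+1)) / 2) *
    ((volume K).toReal / (volume (ball (0 : Euc (n-1)) 1)).toReal) ^ ((2:ℝ)/(n+1))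

/-- The function `G_S(x) = c(S,n)·κ(x)^{1/(n+1)} / ⟨x, u(x)⟩`. -/
def Gfun {n : ℕ} (S : Set (Euc n)) (u : Euc n → Euc n) (κ : Euc n → ℝ) (x : Euc n) : ℝ :=
  cConst n S * (κ x) ^ ((1:ℝ)/(n+1)) / ⟪x, u x⟫

/-- The unit ball of `ℓ_p^n`. -/
def lpBall (n : ℕ) (p : ℝ) : Set (Euc n) :=
  {x | (∑ i, |x i| ^ p) ≤ 1}

lemma euc_volume_eq {n : ℕ} (s : Set (Euc n)) :
    volume s = volume ((fun x : Fin n → ℝ => (WithLp.toLp 2 x : Euc n)) ⁻¹' s) :=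
  ((EuclideanSpace.volume_preserving_symm_measurableEquiv_toLp (Fin n)).symm.measure_preimage_equiv
    s).symm

lemma euc_inner_eq {n : ℕ} (x y : Euc n) : ⟪x, y⟫ = ∑ i, x i * y i := by
  simp [PiLp.inner_apply, mul_comm]

lemma euc_norm_sq_eq {n : ℕ} (x : Euc n) : ‖x‖ ^ 2 = ∑ i, x i ^ 2 :=
  EuclideanSpace.real_norm_sq_eq x

/-- The volume of a solid of sections of a paraboloid, in coordinates. -/
lemma volume_paraboloid (m : ℕ) {S T : ℝ} (hS : 0 ≤ S) (hT : 0 ≤ T) :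
    volume {ζ : Euc (m + 1) | 0 ≤ ζ 0 ∧ ζ 0 ≤ T ∧ ∑ i : Fin m, ζ i.succ ^ 2 ≤ S * ζ 0}
      = ENNReal.ofReal (S ^ ((m : ℝ) / 2) * (T ^ ((m : ℝ) / 2 + 1) / ((m : ℝ) / 2 + 1)))
        * volume (ball (0 : Euc m) 1) := by
  rw [euc_volume_eq]
  have h1 := (volume_preserving_piFinSuccAbove (fun _ : Fin (m + 1) => ℝ) 0).symm
  rw [← h1.measure_preimage_equiv]
  set s : Set (ℝ × (Fin m → ℝ)) :=
    {q | 0 ≤ q.1 ∧ q.1 ≤ T ∧ ∑ i : Fin m, q.2 i ^ 2 ≤ S * q.1} with hs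
  have hpre : ((MeasurableEquiv.piFinSuccAbove (fun _ : Fin (m + 1) => ℝ) 0).symm ⁻¹'
      ((fun x : Fin (m + 1) → ℝ => (WithLp.toLp 2 x : Euc (m + 1))) ⁻¹'
        {ζ : Euc (m + 1) | 0 ≤ ζ 0 ∧ ζ 0 ≤ T ∧ ∑ i : Fin m, ζ i.succ ^ 2 ≤ S * ζ 0})) = s := by
    ext ⟨t, y⟩
    simp [hs]
  rw [hpre]
  have hsm : MeasurableSet s := by
    apply IsClosed.measurableSet
    simp only [hs, ofPred_and]
    refine (isClosed_le (by fun_prop) (by fun_prop)).inter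
      ((isClosed_le (by fun_prop) (by fun_prop)).inter (isClosed_le (by fun_prop) (by fun_prop)))
  have hvol : (volume : Measure (ℝ × (Fin m → ℝ))) = (volume : Measure ℝ).prod volume := rfl
  rw [hvol, Measure.prod_apply hsm]
  have hsec : ∀ t : ℝ, volume (Prod.mk t ⁻¹' s) = (Icc 0 T).indicator
      (fun t => ENNReal.ofReal (S ^ ((m : ℝ) / 2) * t ^ ((m : ℝ) / 2)) *
        volume (ball (0 : Euc m) 1)) t := by
    intro t
    by_cases ht : t ∈ Icc 0 T
    · rw [indicator_of_mem ht]
      have hSt : 0 ≤ S * t := mul_nonneg hS ht.1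
      have : Prod.mk t ⁻¹' s = (fun x : Fin m → ℝ => (WithLp.toLp 2 x : Euc m)) ⁻¹'
          closedBall 0 (Real.sqrt (S * t)) := by
        ext y
        simp only [hs, mem_preimage, mem_ofPred_eq, mem_closedBall, dist_zero_right]
        rw [← Real.sqrt_sq (norm_nonneg _), Real.sqrt_le_sqrt_iff hSt, euc_norm_sq_eq]
        simp [ht.1, ht.2]
      rw [this, ← euc_volume_eq, Measure.addHaar_closedBall _ _ (Real.sqrt_nonneg _)]
      congr 2
      rw [finrank_euclideanSpace_fin, ← Real.mul_rpow hS ht.1, Real.sqrt_eq_rpow,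
        ← Real.rpow_natCast, ← Real.rpow_mul hSt]
      congr 1; ring
    · rw [indicator_of_notMem ht]
      have : Prod.mk t ⁻¹' s = ∅ := by
        ext y
        simp only [hs, mem_preimage, mem_ofPred_eq, mem_empty_iff_false, iff_false]
        rintro ⟨h1, h2, -⟩
        exact ht ⟨h1, h2⟩
      rw [this, measure_empty]
  simp_rw [hsec]
  have hm0 : (0 : ℝ) ≤ (m : ℝ) / 2 := by positivity
  have hcont : Continuous fun t : ℝ => S ^ ((m : ℝ) / 2) * t ^ ((m : ℝ) / 2) := by
    have := Real.continuous_rpow_const hm0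
    fun_prop
  rw [lintegral_indicator measurableSet_Icc, lintegral_mul_const _ (by fun_prop)]
  congr 1
  rw [← ofReal_integral_eq_lintegral_ofReal]
  · congr 1
    rw [integral_Icc_eq_integral_Ioc, ← intervalIntegral.integral_of_le hT,
      intervalIntegral.integral_const_mul, integral_rpow (Or.inl (by linarith)),
      Real.zero_rpow (by linarith), sub_zero]
  · exact hcont.continuousOn.integrableOn_Icc
  · filter_upwards [ae_restrict_mem measurableSet_Icc] with t ht
    have := ht.1
    positivity

/-- The volume of a solid of sections of a paraboloid with an arbitrary axis. -/
lemma volume_paraboloid_axis {m : ℕ} {S T : ℝ} (hS : 0 ≤ S) (hT : 0 ≤ T) {e : Euc (m + 1)}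
    (he : ‖e‖ = 1) :
    volume {ζ : Euc (m + 1) | 0 ≤ ⟪e, ζ⟫ ∧ ⟪e, ζ⟫ ≤ T ∧ ‖ζ‖ ^ 2 - ⟪e, ζ⟫ ^ 2 ≤ S * ⟪e, ζ⟫}
      = ENNReal.ofReal (S ^ ((m : ℝ) / 2) * (T ^ ((m : ℝ) / 2 + 1) / ((m : ℝ) / 2 + 1)))
        * volume (ball (0 : Euc m) 1) := by
  have ho : Orthonormal ℝ (({0} : Set (Fin (m + 1))).domRestrict (fun _ => e)) := by
    constructor
    · rintro ⟨i, hi⟩; exact he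
    · rintro ⟨i, hi⟩ ⟨j, hj⟩ hij
      exact absurd (Subtype.ext ((mem_singleton_iff.1 hi).trans (mem_singleton_iff.1 hj).symm)) hij
  obtain ⟨b, hb⟩ := ho.exists_orthonormalBasis_extension_of_card_eq (by simp)
  have hb0 : b 0 = e := hb 0 rfl
  rw [← volume_paraboloid m hS hT]
  symm
  rw [← b.measurePreserving_measurableEquiv.measure_preimage_equiv]
  congr 1
  ext ζ
  have h0 : b.repr ζ 0 = ⟪e, ζ⟫ := by rw [b.repr_apply_apply, hb0]
  have hn : ‖ζ‖ ^ 2 = b.repr ζ 0 ^ 2 + ∑ i : Fin m, b.repr ζ i.succ ^ 2 := by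
    rw [← Fin.sum_univ_succ (fun i => b.repr ζ i ^ 2), ← euc_norm_sq_eq, LinearIsometryEquiv.norm_map]
  simp only [mem_ofPred_eq, mem_preimage]
  change 0 ≤ b.repr ζ 0 ∧ b.repr ζ 0 ≤ T ∧ ∑ i : Fin m, b.repr ζ i.succ ^ 2 ≤ S * b.repr ζ 0 ↔ _
  rw [h0] at hn ⊢
  rw [hn]
  simp

lemma volume_preimage_diag {n : ℕ} {D : Fin n → ℝ} (hD : ∀ i, 0 < D i) (s : Set (Euc n)) :
    volume {z : Euc n | (WithLp.toLp 2 (fun i => D i * z i) : Euc n) ∈ s}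
      = ENNReal.ofReal (∏ i, D i)⁻¹ * volume s := by
  have hp : 0 < ∏ i, D i := Finset.prod_pos fun i _ => hD i
  have hdet : LinearMap.det (Matrix.toLin' (Matrix.diagonal D)) = ∏ i, D i := by
    rw [LinearMap.det_toLin', Matrix.det_diagonal]
  have := Measure.addHaar_preimage_linearMap (volume : Measure (Fin n → ℝ))
    (f := Matrix.toLin' (Matrix.diagonal D)) (by rw [hdet]; exact hp.ne')
    ((fun x : Fin n → ℝ => (WithLp.toLp 2 x : Euc n)) ⁻¹' s)
  rw [euc_volume_eq s, euc_volume_eq]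
  rw [hdet, abs_of_pos (inv_pos.2 hp)] at this
  rw [← this]
  congr 1
  ext x
  simp only [mem_preimage, mem_ofPred_eq, Matrix.toLin'_apply]
  have : (Matrix.diagonal D).mulVec x = fun i => D i * x i := by
    ext i; rw [Matrix.mulVec_diagonal]
  rw [this]

/-- The cap of height `η` at the origin of the ellipsoid `½ ∑ Aᵢ zᵢ² ≤ -⟪v, z⟫`. -/
def quadCap {n : ℕ} (A : Fin n → ℝ) (v : Euc n) (η : ℝ) : Set (Euc n) :=
  {z | (∑ i, A i * z i ^ 2) / 2 ≤ -⟪v, z⟫ ∧ -⟪v, z⟫ ≤ η}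

/-- The solid paraboloid used to compare with `quadCap`. -/
def paraCap {n : ℕ} (A : Fin n → ℝ) (v : Euc n) (η σ : ℝ) : Set (Euc n) :=
  {z | 0 ≤ -⟪v, z⟫ ∧ -⟪v, z⟫ ≤ η ∧
    ∑ i, A i * z i ^ 2 - ⟪v, z⟫ ^ 2 / (∑ i, v i ^ 2 / A i) ≤ σ * -⟪v, z⟫}

lemma volume_paraCap {m : ℕ} {A : Fin (m + 1) → ℝ} (hA : ∀ i, 0 < A i) {v : Euc (m + 1)}
    (hN : 0 < ∑ i, v i ^ 2 / A i) {η σ : ℝ} (hη : 0 ≤ η) (hσ : 0 ≤ σ) :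
    volume (paraCap A v η σ) = ENNReal.ofReal (σ ^ ((m : ℝ) / 2) * (η ^ ((m : ℝ) / 2 + 1)
      / ((m : ℝ) / 2 + 1)) / √((∑ i, v i ^ 2 / A i) * ∏ i, A i)) *
        volume (ball (0 : Euc m) 1) := by
  set N := ∑ i, v i ^ 2 / A i with hNdef
  have hsN : 0 < √N := Real.sqrt_pos.2 hN
  have hsA : ∀ i, 0 < √(A i) := fun i => Real.sqrt_pos.2 (hA i)
  set e : Euc (m + 1) := WithLp.toLp 2 (fun i => -v i / (√(A i) * √N)) with he
  have hen : ‖e‖ = 1 := by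
    have : ‖e‖ ^ 2 = 1 := by
      rw [euc_norm_sq_eq]
      have : ∀ i, e i ^ 2 = (v i ^ 2 / A i) / N := by
        intro i
        simp only [he]
        rw [div_pow, mul_pow, Real.sq_sqrt (hA i).le, Real.sq_sqrt hN.le, neg_sq, div_div]
      simp_rw [this]
      rw [← Finset.sum_div, ← hNdef, div_self hN.ne']
    nlinarith [norm_nonneg e]
  have hset : paraCap A v η σ = {z : Euc (m + 1) | (WithLp.toLp 2 (fun i => √(A i) * z i) :
      Euc (m + 1)) ∈ {ζ : Euc (m + 1) | 0 ≤ ⟪e, ζ⟫ ∧ ⟪e, ζ⟫ ≤ η / √N ∧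
        ‖ζ‖ ^ 2 - ⟪e, ζ⟫ ^ 2 ≤ (√N * σ) * ⟪e, ζ⟫}} := by
    ext z
    have h1 : ⟪e, (WithLp.toLp 2 (fun i => √(A i) * z i) : Euc (m + 1))⟫ = -⟪v, z⟫ / √N := by
      rw [euc_inner_eq, euc_inner_eq, ← Finset.sum_neg_distrib, Finset.sum_div]
      refine Finset.sum_congr rfl fun i _ => ?_
      have := hsA i
      simp only [he]
      field_simp
    have h2 : ‖(WithLp.toLp 2 (fun i => √(A i) * z i) : Euc (m + 1))‖ ^ 2
        = ∑ i, A i * z i ^ 2 := by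
      rw [euc_norm_sq_eq]
      refine Finset.sum_congr rfl fun i _ => ?_
      simp only [mul_pow, Real.sq_sqrt (hA i).le]
    simp only [paraCap, mem_ofPred_eq, h1, h2]
    rw [div_le_div_iff_of_pos_right hsN, le_div_iff₀ hsN, zero_mul, div_pow, Real.sq_sqrt hN.le,
      neg_sq, ← hNdef]
    have : √N * σ * (-⟪v, z⟫ / √N) = σ * -⟪v, z⟫ := by field_simp
    rw [this]
  rw [hset, volume_preimage_diag hsA, volume_paraboloid_axis (by positivity) (by positivity) hen,
    ← mul_assoc, ← ENNReal.ofReal_mul (by have := Finset.prod_pos fun i (_ : i ∈ Finset.univ) => hsA i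
                                          positivity)]
  congr 2
  have hprod : √(N * ∏ i, A i) = √N * ∏ i, √(A i) := by
    rw [Real.sqrt_mul hN.le, Real.sqrt_prod _ (fun i _ => (hA i).le)]
  have hpp : 0 < ∏ i, √(A i) := Finset.prod_pos fun i _ => hsA i
  rw [hprod, Real.mul_rpow hsN.le hσ, Real.div_rpow hη hsN.le, Real.rpow_add hsN, Real.rpow_one]
  have : 0 < √N ^ ((m : ℝ) / 2) := by positivity
  field_simp

lemma volume_quadCap_le {m : ℕ} {A : Fin (m + 1) → ℝ} (hA : ∀ i, 0 < A i) {v : Euc (m + 1)}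
    (hN : 0 < ∑ i, v i ^ 2 / A i) {η : ℝ} (hη : 0 ≤ η) :
    volume (quadCap A v η) ≤ ENNReal.ofReal (2 ^ ((m : ℝ) / 2) * (η ^ ((m : ℝ) / 2 + 1)
      / ((m : ℝ) / 2 + 1)) / √((∑ i, v i ^ 2 / A i) * ∏ i, A i)) *
        volume (ball (0 : Euc m) 1) := by
  rw [← volume_paraCap hA hN hη zero_le_two]
  refine measure_mono fun z hz => ?_
  obtain ⟨h1, h2⟩ := hz
  have h0 : 0 ≤ ∑ i, A i * z i ^ 2 :=
    Finset.sum_nonneg fun i _ => mul_nonneg (hA i).le (sq_nonneg _)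
  have h3 : 0 ≤ ⟪v, z⟫ ^ 2 / (∑ i, v i ^ 2 / A i) := by positivity
  exact ⟨by linarith, h2, by linarith⟩

lemma le_volume_quadCap {m : ℕ} {A : Fin (m + 1) → ℝ} (hA : ∀ i, 0 < A i) {v : Euc (m + 1)}
    (hN : 0 < ∑ i, v i ^ 2 / A i) {η : ℝ} (hη : 0 ≤ η) (hηN : η ≤ 2 * ∑ i, v i ^ 2 / A i) :
    ENNReal.ofReal ((2 - η / ∑ i, v i ^ 2 / A i) ^ ((m : ℝ) / 2) * (η ^ ((m : ℝ) / 2 + 1)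
      / ((m : ℝ) / 2 + 1)) / √((∑ i, v i ^ 2 / A i) * ∏ i, A i)) *
        volume (ball (0 : Euc m) 1) ≤ volume (quadCap A v η) := by
  have h2 : η / (∑ i, v i ^ 2 / A i) ≤ 2 := by rwa [div_le_iff₀ hN]
  rw [← volume_paraCap hA hN hη (sub_nonneg.2 h2)]
  refine measure_mono fun z hz => ?_
  obtain ⟨h1, h2, h3⟩ := hz
  refine ⟨?_, h2⟩
  set N := ∑ i, v i ^ 2 / A i
  have : ⟪v, z⟫ ^ 2 / N ≤ η / N * -⟪v, z⟫ := by
    rw [div_mul_eq_mul_div, div_le_div_iff_of_pos_right hN]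
    nlinarith
  linarith

/-- The duality map `x ↦ (|xᵢ|^{p-2} xᵢ)ᵢ` of `ℓ_p`. -/
def dualityMap {n : ℕ} (p : ℝ) (x : Euc n) : Euc n :=
  WithLp.toLp 2 (fun i => |x i| ^ (p - 2) * x i)

lemma dualityMap_apply {n : ℕ} (p : ℝ) (x : Euc n) (i : Fin n) :
    dualityMap p x i = |x i| ^ (p - 2) * x i := rfl

lemma abs_rpow_mul_self {p : ℝ} (hp : 1 < p) (t : ℝ) : |(|t| ^ (p - 2) * t)| = |t| ^ (p - 1) := by
  rw [abs_mul, abs_of_nonneg (by positivity : 0 ≤ |t| ^ (p - 2))]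
  rcases eq_or_ne t 0 with rfl | ht
  · rw [abs_zero, Real.zero_rpow (by linarith : p - 1 ≠ 0), mul_zero]
  · nth_rewrite 2 [← Real.rpow_one |t|]
    rw [← Real.rpow_add (abs_pos.2 ht)]
    congr 1; ring

lemma abs_rpow_mul_sq {p : ℝ} (hp : 1 < p) (t : ℝ) : |t| ^ (p - 2) * t * t = |t| ^ p := by
  have h := abs_rpow_mul_self hp t
  rw [abs_mul, abs_of_nonneg (by positivity : 0 ≤ |t| ^ (p - 2))] at h
  rw [mul_assoc, ← abs_mul_abs_self, ← mul_assoc, h]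
  rcases eq_or_ne t 0 with rfl | ht
  · rw [abs_zero, Real.zero_rpow (by linarith : p - 1 ≠ 0), mul_zero,
      Real.zero_rpow (by linarith : p ≠ 0)]
  · nth_rewrite 2 [← Real.rpow_one |t|]
    rw [← Real.rpow_add (abs_pos.2 ht)]
    congr 1; ring

lemma inner_dualityMap_self {n : ℕ} {p : ℝ} (hp : 1 < p) (x : Euc n) :
    ⟪dualityMap p x, x⟫ = ∑ i, |x i| ^ p := by
  rw [euc_inner_eq]
  exact Finset.sum_congr rfl fun i _ => abs_rpow_mul_sq hp _

lemma sum_abs_dualityMap {n : ℕ} {p q : ℝ} (hpq : p.HolderConjugate q) (x : Euc n) :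
    ∑ i, |dualityMap p x i| ^ q = ∑ i, |x i| ^ p := by
  refine Finset.sum_congr rfl fun i _ => ?_
  rw [dualityMap_apply, abs_rpow_mul_self hpq.lt, ← Real.rpow_mul (abs_nonneg _),
    hpq.sub_one_mul_conj]

lemma dualityMap_dualityMap {n : ℕ} {p q : ℝ} (hpq : p.HolderConjugate q) (x : Euc n) :
    dualityMap p (dualityMap q x) = x := by
  ext i
  rw [dualityMap_apply, dualityMap_apply, abs_rpow_mul_self hpq.symm.lt,
    ← Real.rpow_mul (abs_nonneg _), ← mul_assoc]
  rcases eq_or_ne (x i) 0 with h | h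
  · simp [h]
  · rw [← Real.rpow_add (abs_pos.2 h)]
    have h1 := hpq.sub_one_mul_conj
    have h2 := hpq.mul_eq_add
    have : (q - 1) * (p - 2) + (q - 2) = 0 := by linarith
    rw [this, Real.rpow_zero, one_mul]

lemma dualityMap_smul {n : ℕ} (p : ℝ) {c : ℝ} (hc : 0 < c) (x : Euc n) :
    dualityMap p (c • x) = c ^ (p - 1) • dualityMap p x := by
  ext i
  simp only [dualityMap_apply, PiLp.smul_apply, smul_eq_mul]
  rw [abs_mul, abs_of_pos hc, Real.mul_rpow hc.le (abs_nonneg _)]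
  have : c ^ (p - 1) = c ^ (p - 2) * c := by
    nth_rewrite 3 [← Real.rpow_one c]
    rw [← Real.rpow_add hc]
    congr 1; ring
  rw [this]; ring

lemma sum_abs_smul {n : ℕ} (p : ℝ) (c : ℝ) (x : Euc n) :
    ∑ i, |(c • x) i| ^ p = |c| ^ p * ∑ i, |x i| ^ p := by
  rw [Finset.mul_sum]
  refine Finset.sum_congr rfl fun i _ => ?_
  rw [PiLp.smul_apply, smul_eq_mul, abs_mul, Real.mul_rpow (abs_nonneg _) (abs_nonneg _)]

lemma sum_abs_pos {n : ℕ} {p : ℝ} {x : Euc n} (hx : x ≠ 0) : 0 < ∑ i, |x i| ^ p := by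
  have : ∃ i, x i ≠ 0 := by
    by_contra! h
    exact hx (by ext i; simp [h i])
  obtain ⟨i, hi⟩ := this
  exact Finset.sum_pos' (fun j _ => by positivity)
    ⟨i, Finset.mem_univ _, Real.rpow_pos_of_pos (abs_pos.2 hi) _⟩

/-- Every nonzero vector is a positive multiple of a value of the duality map on the sphere. -/
lemma exists_eq_smul_dualityMap {n : ℕ} {p q : ℝ} (hpq : p.HolderConjugate q) {v : Euc n}
    (hv : v ≠ 0) : ∃ (x : Euc n) (M : ℝ), 0 < M ∧ ∑ i, |x i| ^ p = 1 ∧ v = M • dualityMap p x := by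
  set y := dualityMap q v with hy
  have hs : 0 < ∑ i, |y i| ^ p := by
    rw [hy, sum_abs_dualityMap hpq.symm]; exact sum_abs_pos hv
  set s := ∑ i, |y i| ^ p with hsdef
  have hc : 0 < s ^ (-(1 / p)) := by positivity
  refine ⟨s ^ (-(1 / p)) • y, ((s ^ (-(1 / p))) ^ (p - 1))⁻¹, by positivity, ?_, ?_⟩
  · rw [sum_abs_smul, ← hsdef, abs_of_pos hc, ← Real.rpow_mul hs.le]
    have : -(1 / p) * p = -1 := by have := hpq.ne_zero; field_simp
    rw [this, Real.rpow_neg_one, inv_mul_cancel₀ hs.ne']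
  · rw [dualityMap_smul p hc, hy, dualityMap_dualityMap hpq, smul_smul,
      inv_mul_cancel₀ (by positivity), one_smul]

lemma inner_le_one_of_mem_lpBall {n : ℕ} {p q : ℝ} (hpq : p.HolderConjugate q) {x y : Euc n}
    (hx : x ∈ lpBall n p) (hy : y ∈ lpBall n q) : ⟪x, y⟫ ≤ 1 := by
  have h : ∀ i, x i * y i ≤ |x i| ^ p / p + |y i| ^ q / q :=
    fun i => Real.young_inequality _ _ hpq
  rw [euc_inner_eq]
  have hx' : ∑ i, |x i| ^ p ≤ 1 := hx
  have hy' : ∑ i, |y i| ^ q ≤ 1 := hy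
  calc ∑ i, x i * y i ≤ ∑ i, (|x i| ^ p / p + |y i| ^ q / q) := Finset.sum_le_sum fun i _ => h i
    _ = (∑ i, |x i| ^ p) / p + (∑ i, |y i| ^ q) / q := by
      rw [Finset.sum_add_distrib, Finset.sum_div, Finset.sum_div]
    _ ≤ 1 / p + 1 / q := by
      have := hpq.pos
      have := hpq.symm.pos
      gcongr
    _ = 1 := by rw [one_div, one_div]; exact hpq.inv_add_inv_eq_one

lemma polarBody_lpBall (n : ℕ) {p q : ℝ} (hpq : p.HolderConjugate q) :
    polarBody (lpBall n p) = lpBall n q := by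
  ext y
  refine ⟨fun hy => ?_, fun hy x hx => inner_le_one_of_mem_lpBall hpq hx hy⟩
  rcases eq_or_ne y 0 with rfl | h0
  · simp [lpBall, Real.zero_rpow hpq.symm.ne_zero]
  · obtain ⟨x, M, hM, hx, rfl⟩ := exists_eq_smul_dualityMap hpq h0
    have h1 : ⟪x, M • dualityMap p x⟫ ≤ 1 := hy x hx.le
    rw [real_inner_smul_right, real_inner_comm, inner_dualityMap_self hpq.lt, hx, mul_one] at h1
    change ∑ i, |(M • dualityMap p x) i| ^ q ≤ 1
    rw [sum_abs_smul, sum_abs_dualityMap hpq, hx, mul_one, abs_of_pos hM]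
    exact Real.rpow_le_one hM.le h1 hpq.symm.nonneg

lemma continuous_sum_abs_rpow {n : ℕ} {p : ℝ} (hp : 0 < p) :
    Continuous fun x : Euc n => ∑ i, |x i| ^ p := by
  have := Real.continuous_rpow_const hp.le
  fun_prop

lemma isClosed_lpBall (n : ℕ) {p : ℝ} (hp : 0 < p) : IsClosed (lpBall n p) :=
  isClosed_le (continuous_sum_abs_rpow hp) continuous_const

lemma abs_le_one_of_mem_lpBall {n : ℕ} {p : ℝ} (hp : 0 < p) {x : Euc n} (hx : x ∈ lpBall n p)
    (i : Fin n) : |x i| ≤ 1 := by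
  have h1 : |x i| ^ p ≤ ∑ j, |x j| ^ p :=
    Finset.single_le_sum (f := fun j => |x j| ^ p) (fun j _ => by positivity) (Finset.mem_univ i)
  have h2 : |x i| ^ p ≤ 1 := h1.trans hx
  by_contra! h
  exact absurd h2 (not_le.2 (Real.one_lt_rpow h hp))

lemma norm_le_of_mem_lpBall {n : ℕ} {p : ℝ} (hp : 0 < p) {x : Euc n} (hx : x ∈ lpBall n p) :
    ‖x‖ ≤ √n := by
  apply Real.le_sqrt_of_sq_le
  rw [euc_norm_sq_eq]
  calc ∑ i, x i ^ 2 ≤ ∑ _i : Fin n, (1 : ℝ) := Finset.sum_le_sum fun i _ => by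
        rw [← sq_abs]; exact pow_le_one₀ (abs_nonneg _) (abs_le_one_of_mem_lpBall hp hx i)
    _ = n := by simp

lemma isCompact_lpBall (n : ℕ) {p : ℝ} (hp : 0 < p) : IsCompact (lpBall n p) :=
  isCompact_of_isClosed_isBounded (isClosed_lpBall n hp)
    (isBounded_iff_forall_norm_le.2 ⟨_, fun _ hx => norm_le_of_mem_lpBall hp hx⟩)

lemma convex_lpBall (n : ℕ) {p : ℝ} (hp : 1 ≤ p) : Convex ℝ (lpBall n p) := by
  intro x hx y hy a b ha hb hab
  change ∑ i, |(a • x + b • y) i| ^ p ≤ 1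
  have hx' : ∑ i, |x i| ^ p ≤ 1 := hx
  have hy' : ∑ i, |y i| ^ p ≤ 1 := hy
  calc ∑ i, |(a • x + b • y) i| ^ p ≤ ∑ i, (a * |x i| ^ p + b * |y i| ^ p) := by
        refine Finset.sum_le_sum fun i _ => ?_
        have h1 : |(a • x + b • y) i| ≤ a * |x i| + b * |y i| := by
          simp only [PiLp.add_apply, PiLp.smul_apply, smul_eq_mul]
          refine (abs_add_le _ _).trans ?_
          rw [abs_mul, abs_mul, abs_of_nonneg ha, abs_of_nonneg hb]
        refine (Real.rpow_le_rpow (abs_nonneg _) h1 (by linarith)).trans ?_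
        exact (convexOn_rpow hp).2 (abs_nonneg (x i)) (abs_nonneg (y i)) ha hb hab
    _ = a * ∑ i, |x i| ^ p + b * ∑ i, |y i| ^ p := by
        rw [Finset.sum_add_distrib, Finset.mul_sum, Finset.mul_sum]
    _ ≤ a * 1 + b * 1 := by gcongr
    _ = 1 := by linarith

lemma zero_mem_lpBall (n : ℕ) {p : ℝ} (hp : 0 < p) : (0 : Euc n) ∈ lpBall n p := by
  simp [lpBall, Real.zero_rpow hp.ne']

lemma neg_mem_lpBall {n : ℕ} {p : ℝ} {x : Euc n} (hx : x ∈ lpBall n p) : -x ∈ lpBall n p := by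
  simpa [lpBall] using hx

lemma mem_smul_lpBall_iff {n : ℕ} {p : ℝ} {a : ℝ} (ha : 0 < a) {x : Euc n} :
    x ∈ a • lpBall n p ↔ ∑ i, |x i| ^ p ≤ a ^ p := by
  rw [mem_smul_set_iff_inv_smul_mem₀ ha.ne']
  change ∑ i, |(a⁻¹ • x) i| ^ p ≤ 1 ↔ _
  rw [sum_abs_smul, abs_of_pos (inv_pos.2 ha), Real.inv_rpow ha.le, inv_mul_le_iff₀ (by positivity),
    mul_one]

lemma interior_lpBall_nonempty (n : ℕ) {p : ℝ} (hp : 0 < p) : (interior (lpBall n p)).Nonempty := by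
  refine ⟨0, mem_interior.2 ⟨{x | ∑ i, |x i| ^ p < 1}, fun x (hx : ∑ i, |x i| ^ p < 1) => hx.le,
    isOpen_lt (continuous_sum_abs_rpow hp) continuous_const, ?_⟩⟩
  simp [Real.zero_rpow hp.ne']

lemma volume_lpBall_pos (n : ℕ) {p : ℝ} (hp : 0 < p) : 0 < volume (lpBall n p) :=
  Measure.measure_pos_of_nonempty_interior _ (interior_lpBall_nonempty n hp)

lemma volume_lpBall_lt_top (n : ℕ) {p : ℝ} (hp : 0 < p) : volume (lpBall n p) < ⊤ :=
  (isCompact_lpBall n hp).measure_lt_top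

lemma volume_lpBall_toReal_pos (n : ℕ) {p : ℝ} (hp : 0 < p) : 0 < (volume (lpBall n p)).toReal :=
  ENNReal.toReal_pos (volume_lpBall_pos n hp).ne' (volume_lpBall_lt_top n hp).ne

lemma frontier_lpBall (n : ℕ) {p : ℝ} (hp : 0 < p) :
    frontier (lpBall n p) = {x | ∑ i, |x i| ^ p = 1} := by
  ext x
  rw [(isClosed_lpBall n hp).frontier_eq]
  constructor
  · rintro ⟨h1, h2⟩
    refine le_antisymm h1 (not_lt.1 fun h => h2 ?_)
    exact mem_interior.2 ⟨{x | ∑ i, |x i| ^ p < 1}, fun x (hx : ∑ i, |x i| ^ p < 1) => hx.le,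
      isOpen_lt (continuous_sum_abs_rpow hp) continuous_const, h⟩
  · intro h
    have h : ∑ i, |x i| ^ p = 1 := h
    refine ⟨h.le, fun hx => ?_⟩
    have hc : Tendsto (fun t : ℝ => t • x) (𝓝[>] 1) (𝓝 x) := by
      have : Continuous fun t : ℝ => t • x := by fun_prop
      simpa using (this.tendsto 1).mono_left nhdsWithin_le_nhds
    have h1 := hc.eventually (mem_interior_iff_mem_nhds.1 hx)
    obtain ⟨t, ht1, ht2⟩ := (h1.and self_mem_nhdsWithin).exists
    have ht1 : ∑ i, |(t • x) i| ^ p ≤ 1 := ht1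
    have ht2 : 1 < t := ht2
    rw [sum_abs_smul, h, mul_one, abs_of_pos (by linarith)] at ht1
    exact absurd ht1 (not_le.2 (Real.one_lt_rpow ht2 hp))

lemma hasDerivAt_abs_rpow_mul_self {p : ℝ} (hp : 2 < p) (t : ℝ) :
    HasDerivAt (fun t : ℝ => |t| ^ (p - 2) * t) ((p - 1) * |t| ^ (p - 2)) t := by
  have key : ∀ t : ℝ, 0 < t → HasDerivAt (fun t : ℝ => |t| ^ (p - 2) * t)
      ((p - 1) * |t| ^ (p - 2)) t := by
    intro t ht
    have h1 : HasDerivAt (fun t : ℝ => t ^ (p - 1)) ((p - 1) * t ^ (p - 1 - 1)) t :=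
      Real.hasDerivAt_rpow_const (Or.inl ht.ne')
    rw [abs_of_pos ht]
    convert! h1.congr_of_eventuallyEq _ using 1
    · congr 2; ring
    · filter_upwards [lt_mem_nhds ht] with s hs
      rw [abs_of_pos hs]
      nth_rewrite 2 [← Real.rpow_one s]
      rw [← Real.rpow_add hs]
      congr 1; ring
  rcases lt_trichotomy t 0 with h | h | h
  · have h1 := key (-t) (by linarith)
    have h2 := (h1.comp t (hasDerivAt_neg t)).neg
    rw [abs_neg] at h2
    convert! h2 using 1
    · ext s; simp
    · ring
  · subst h
    rw [abs_zero, Real.zero_rpow (by linarith), mul_zero, hasDerivAt_iff_tendsto_slope]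
    have hc : Tendsto (fun s : ℝ => |s| ^ (p - 2)) (𝓝[≠] 0) (𝓝 0) := by
      have : Continuous fun s : ℝ => |s| ^ (p - 2) :=
        (Real.continuous_rpow_const (by linarith)).comp continuous_abs
      have h0 := this.tendsto 0
      rw [abs_zero, Real.zero_rpow (by linarith)] at h0
      exact h0.mono_left nhdsWithin_le_nhds
    refine hc.congr' ?_
    filter_upwards [self_mem_nhdsWithin] with s hs
    have hs : s ≠ 0 := hs
    simp [slope_def_field, hs]
  · exact key t h

/-- Second order Taylor expansion of `|t| ^ p`, uniformly for `t` in `[-1, 1]`. -/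
lemma abs_rpow_taylor {p : ℝ} (hp : 2 < p) {ω : ℝ} (hω : 0 < ω) :
    ∃ r > 0, ∀ t : ℝ, |t| ≤ 1 → ∀ s : ℝ, |s| ≤ r →
      |(|t + s| ^ p - |t| ^ p - p * (|t| ^ (p - 2) * t) * s
        - p * ((p - 1) * |t| ^ (p - 2)) / 2 * s ^ 2)| ≤ ω * s ^ 2 := by
  set ψ : ℝ → ℝ := fun t => p * ((p - 1) * |t| ^ (p - 2)) with hψ
  have hψc : Continuous ψ := by
    have : Continuous fun s : ℝ => |s| ^ (p - 2) :=
      (Real.continuous_rpow_const (by linarith)).comp continuous_abs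
    fun_prop
  have huc := (isCompact_Icc (a := (-2 : ℝ)) (b := 2)).uniformContinuousOn_of_continuous
    hψc.continuousOn
  obtain ⟨δ, hδ, hd⟩ := Metric.uniformContinuousOn_iff.1 huc ω hω
  refine ⟨min 1 (δ / 2), by positivity, fun t ht s hs => ?_⟩
  have hs1 : |s| ≤ 1 := hs.trans (min_le_left _ _)
  have hs2 : |s| < δ := (hs.trans (min_le_right _ _)).trans_lt (by linarith)
  have hψ' : ∀ y ∈ uIcc 0 s, |ψ (t + y) - ψ t| ≤ ω := by
    intro y hy
    have hys : |y| ≤ |s| := by simpa using abs_sub_left_of_mem_uIcc hy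
    have h := hd (t + y) ?_ t ?_ ?_
    · exact (by simpa [Real.dist_eq] using h.le)
    · have := abs_le.1 ht; have := abs_le.1 (hys.trans hs1); constructor <;> linarith
    · have := abs_le.1 ht; constructor <;> linarith
    · simpa [Real.dist_eq] using hys.trans_lt hs2
  have hd1 : ∀ y : ℝ, HasDerivAt (fun y => p * (|t + y| ^ (p - 2) * (t + y))
      - p * (|t| ^ (p - 2) * t) - ψ t * y) (ψ (t + y) - ψ t) y := by
    intro y
    have h1 := ((hasDerivAt_abs_rpow_mul_self hp (t + y)).comp_const_add t y).const_mul p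
    have h2 := (h1.sub_const (p * (|t| ^ (p - 2) * t))).sub
      ((hasDerivAt_id y).const_mul (ψ t))
    convert! h2 using 1
    simp [hψ]
  have hg1 : ∀ y ∈ uIcc 0 s, |p * (|t + y| ^ (p - 2) * (t + y))
      - p * (|t| ^ (p - 2) * t) - ψ t * y| ≤ ω * |s| := by
    intro y hy
    have := (convex_uIcc (0 : ℝ) s).norm_image_sub_le_of_norm_hasDerivWithin_le
      (fun z _ => (hd1 z).hasDerivWithinAt) (fun z hz => hψ' z hz) left_mem_uIcc hy
    simp only [add_zero, mul_zero, sub_zero, sub_self, Real.norm_eq_abs] at this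
    refine this.trans ?_
    have hys : |y| ≤ |s| := by simpa using abs_sub_left_of_mem_uIcc hy
    gcongr
  have hd2 : ∀ y : ℝ, HasDerivAt (fun y => |t + y| ^ p - |t| ^ p - p * (|t| ^ (p - 2) * t) * y
      - ψ t / 2 * y ^ 2) (p * (|t + y| ^ (p - 2) * (t + y))
      - p * (|t| ^ (p - 2) * t) - ψ t * y) y := by
    intro y
    have h1 := (hasDerivAt_abs_rpow (t + y) (by linarith : 1 < p)).comp_const_add t y
    have h2 := ((h1.sub_const (|t| ^ p)).sub
      ((hasDerivAt_id y).const_mul (p * (|t| ^ (p - 2) * t)))).sub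
      ((hasDerivAt_pow 2 y).const_mul (ψ t / 2))
    convert! h2 using 1
    simp only [Nat.cast_ofNat, mul_one]
    ring
  have := (convex_uIcc (0 : ℝ) s).norm_image_sub_le_of_norm_hasDerivWithin_le
      (fun z _ => (hd2 z).hasDerivWithinAt) (fun z hz => hg1 z hz) left_mem_uIcc right_mem_uIcc
  simp only [add_zero, mul_zero, sub_zero, sub_self, Real.norm_eq_abs, ne_eq, OfNat.ofNat_ne_zero,
    not_false_eq_true, zero_pow] at this
  refine this.trans (le_of_eq ?_)
  rw [mul_assoc, abs_mul_abs_self, sq]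

/-- A global quadratic lower bound for `|1 + u| ^ p`. -/
lemma one_add_quadratic_le_abs_rpow {p : ℝ} (hp : 2 ≤ p) (u : ℝ) :
    1 + p * u + p / 2 * u ^ 2 ≤ |1 + u| ^ p := by
  have h := one_add_mul_self_le_rpow_one_add (s := 2 * u + u ^ 2) (by nlinarith [sq_nonneg (1 + u)])
    (p := p / 2) (by linarith)
  have h2 : (1 + (2 * u + u ^ 2)) ^ (p / 2) = |1 + u| ^ p := by
    have : 1 + (2 * u + u ^ 2) = |1 + u| ^ (2 : ℝ) := by
      rw [Real.rpow_two, sq_abs]; ring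
    rw [this, ← Real.rpow_mul (abs_nonneg _)]
    congr 1; ring
  rw [h2] at h
  linarith

/-- A global quadratic upper bound for `|1 + u| ^ q`. -/
lemma abs_rpow_le_one_add_quadratic {q : ℝ} (hq0 : 0 ≤ q) (hq : q ≤ 2) (u : ℝ) :
    |1 + u| ^ q ≤ 1 + q * u + q / 2 * u ^ 2 := by
  have h := rpow_one_add_le_one_add_mul_self (s := 2 * u + u ^ 2)
    (by nlinarith [sq_nonneg (1 + u)]) (p := q / 2) (by linarith) (by linarith)
  have h2 : (1 + (2 * u + u ^ 2)) ^ (q / 2) = |1 + u| ^ q := by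
    have : 1 + (2 * u + u ^ 2) = |1 + u| ^ (2 : ℝ) := by
      rw [Real.rpow_two, sq_abs]; ring
    rw [this, ← Real.rpow_mul (abs_nonneg _)]
    congr 1; ring
  rw [h2] at h
  linarith

/-- The weight `(p - 1) n^{-(p-2)/p}`, the common second order coefficient at the diagonal point. -/
def diagWeight (n : ℕ) (p : ℝ) : ℝ := (p - 1) * ((n : ℝ) ^ (-(1 : ℝ) / p)) ^ (p - 2)

lemma diagWeight_pos {n : ℕ} (hn : 0 < n) {p : ℝ} (hp : 1 < p) : 0 < diagWeight n p := by
  have : (0 : ℝ) < n := by exact_mod_cast hn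
  have : 0 < p - 1 := by linarith
  unfold diagWeight
  positivity

lemma dualityMap_sq {n : ℕ} {p : ℝ} (hp : 1 < p) (x : Euc n) (i : Fin n) :
    dualityMap p x i ^ 2 = |x i| ^ (p - 2) * |x i| ^ p := by
  rw [← abs_rpow_mul_sq hp (x i), dualityMap_apply]; ring

lemma prod_le_mean_pow {n : ℕ} (hn : 0 < n) {A : Fin n → ℝ} (hA : ∀ i, 0 ≤ A i) :
    ∏ i, A i ≤ ((∑ i, A i) / n) ^ n := by
  have hn' : (0 : ℝ) < n := by exact_mod_cast hn
  have h := Real.geom_mean_le_arith_mean_weighted Finset.univ (fun _ : Fin n => 1 / (n : ℝ)) A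
    (fun _ _ => by positivity) (by simp [hn'.ne']) (fun i _ => hA i)
  rw [Real.finsetProd_rpow _ _ (fun i _ => hA i), ← Finset.mul_sum, one_div_mul_eq_div] at h
  have hp : 0 ≤ ∏ i, A i := Finset.prod_nonneg fun i _ => hA i
  calc ∏ i, A i = ((∏ i, A i) ^ (1 / (n : ℝ))) ^ n := by
        rw [← Real.rpow_natCast, ← Real.rpow_mul hp, one_div, inv_mul_cancel₀ hn'.ne', Real.rpow_one]
    _ ≤ _ := by gcongr

lemma sum_abs_rpow_sub_two_le {n : ℕ} (hn : 0 < n) {p : ℝ} (hp : 2 < p) {x : Euc n}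
    (hx : ∑ i, |x i| ^ p = 1) :
    (∑ i, |x i| ^ (p - 2)) / n ≤ ((n : ℝ) ^ (-(1 : ℝ) / p)) ^ (p - 2) := by
  have hn' : (0 : ℝ) < n := by exact_mod_cast hn
  have hp2 : 0 < p - 2 := by linarith
  have h := Real.arith_mean_le_rpow_mean Finset.univ (fun _ : Fin n => 1 / (n : ℝ))
    (fun i => |x i| ^ (p - 2)) (fun _ _ => by positivity) (by simp [hn'.ne'])
    (fun i _ => by positivity) (p := p / (p - 2)) (by rw [le_div_iff₀ hp2]; linarith)
  have h2 : ∀ i, (|x i| ^ (p - 2)) ^ (p / (p - 2)) = |x i| ^ p := by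
    intro i
    rw [← Real.rpow_mul (abs_nonneg _)]
    congr 1; field_simp
  simp_rw [h2] at h
  rw [← Finset.mul_sum, ← Finset.mul_sum, hx, one_div_mul_eq_div] at h
  refine h.trans (le_of_eq ?_)
  rw [mul_one, one_div (n : ℝ), Real.inv_rpow hn'.le, ← Real.rpow_neg hn'.le, ← Real.rpow_mul hn'.le]
  congr 1
  field_simp

/-- The coefficients of the quadratic form bounding `lpBall` near `x` from inside. -/
def curvWeight {n : ℕ} (p : ℝ) (x : Euc n) (ω : ℝ) (i : Fin n) : ℝ :=
  (p - 1) * |x i| ^ (p - 2) + ω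

lemma curvWeight_pos {n : ℕ} {p : ℝ} (hp : 1 < p) (x : Euc n) {ω : ℝ} (hω : 0 < ω) (i : Fin n) :
    0 < curvWeight p x ω i := by
  have : 0 < p - 1 := by linarith
  unfold curvWeight
  positivity

lemma weighted_prod_le {n : ℕ} (hn : 0 < n) {p : ℝ} (hp : 2 < p) {x : Euc n}
    (hx : ∑ i, |x i| ^ p = 1) {ω : ℝ} (hω : 0 < ω) :
    (∑ i, dualityMap p x i ^ 2 / curvWeight p x ω i) * ∏ i, curvWeight p x ω i
      ≤ (diagWeight n p + ω) ^ n / (p - 1) := by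
  have hn' : (0 : ℝ) < n := by exact_mod_cast hn
  have hp1 : 0 < p - 1 := by linarith
  have hA := fun i => curvWeight_pos (by linarith : 1 < p) x hω i
  have h1 : ∑ i, dualityMap p x i ^ 2 / curvWeight p x ω i ≤ 1 / (p - 1) := by
    have h0 : 1 / (p - 1) = ∑ i, |x i| ^ p / (p - 1) := by rw [← Finset.sum_div, hx]
    rw [h0]
    refine Finset.sum_le_sum fun i _ => ?_
    rw [dualityMap_sq (by linarith), div_le_div_iff₀ (hA i) hp1]
    have : 0 ≤ |x i| ^ p := by positivity
    unfold curvWeight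
    nlinarith
  have h2 : (∑ i, curvWeight p x ω i) / n ≤ diagWeight n p + ω := by
    have := sum_abs_rpow_sub_two_le hn hp hx
    simp only [curvWeight, diagWeight, Finset.sum_add_distrib, ← Finset.mul_sum, Finset.sum_const,
      Finset.card_univ, Fintype.card_fin, nsmul_eq_mul]
    rw [add_div, mul_div_cancel_left₀ _ hn'.ne', mul_div_assoc]
    gcongr
  have h3 : ∏ i, curvWeight p x ω i ≤ (diagWeight n p + ω) ^ n :=
    (prod_le_mean_pow hn fun i => (hA i).le).trans
      (pow_le_pow_left₀ (div_nonneg (Finset.sum_nonneg fun i _ => (hA i).le) hn'.le) h2 _)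
  calc _ ≤ 1 / (p - 1) * (diagWeight n p + ω) ^ n := by
        refine mul_le_mul h1 h3 (Finset.prod_nonneg fun i _ => (hA i).le) (by positivity)
    _ = _ := by ring

lemma le_weighted_sum {n : ℕ} (hn : 0 < n) {p : ℝ} (hp : 2 < p) {x : Euc n}
    (hx : ∑ i, |x i| ^ p = 1) {ω : ℝ} (hω : 0 < ω) (hω1 : ω ≤ 1) :
    1 / (p * (n : ℝ) ^ 2) ≤ ∑ i, dualityMap p x i ^ 2 / curvWeight p x ω i := by
  have hn' : (0 : ℝ) < n := by exact_mod_cast hn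
  have hA := fun i => curvWeight_pos (by linarith : 1 < p) x hω i
  obtain ⟨i, hi⟩ : ∃ i, 1 / (n : ℝ) ≤ |x i| ^ p := by
    by_contra! h
    have : ∑ i, |x i| ^ p < ∑ _i : Fin n, 1 / (n : ℝ) :=
      Finset.sum_lt_sum_of_nonempty ⟨⟨0, hn⟩, Finset.mem_univ _⟩ fun i _ => h i
    rw [hx] at this
    simp [hn'.ne'] at this
  have hx1 : |x i| ≤ 1 := abs_le_one_of_mem_lpBall (by linarith) (show x ∈ lpBall n p from hx.le) i
  have hle1 : |x i| ^ (p - 2) ≤ 1 := Real.rpow_le_one (abs_nonneg _) hx1 (by linarith)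
  have hAi : curvWeight p x ω i ≤ p := by unfold curvWeight; nlinarith
  have hx0 : 0 < |x i| := by
    rw [abs_pos]
    intro h
    rw [h, abs_zero, Real.zero_rpow (by linarith)] at hi
    have : 0 < 1 / (n : ℝ) := by positivity
    linarith
  have hi2 : 1 / (n : ℝ) ≤ |x i| ^ (p - 2) :=
    hi.trans (Real.rpow_le_rpow_of_exponent_ge hx0 hx1 (by linarith))
  refine le_trans ?_ (Finset.single_le_sum
    (f := fun i => dualityMap p x i ^ 2 / curvWeight p x ω i)
    (fun j _ => div_nonneg (sq_nonneg _) (hA j).le) (Finset.mem_univ i))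
  simp only
  rw [dualityMap_sq (by linarith)]
  calc 1 / (p * (n : ℝ) ^ 2) = (1 / n) * (1 / n) / p := by
        have : p ≠ 0 := by linarith
        field_simp
    _ ≤ |x i| ^ (p - 2) * |x i| ^ p / curvWeight p x ω i := by
        have := hA i
        gcongr

/-- Near any boundary point, `lpBall` contains a translate of the cap of an ellipsoid. -/
lemma quadCap_subset_cap {n : ℕ} {p : ℝ} (hp : 2 < p) {ω : ℝ} (hω : 0 < ω) :
    ∃ η₀ > 0, ∀ x : Euc n, ∑ i, |x i| ^ p = 1 → ∀ η ≤ η₀,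
      ∀ z ∈ quadCap (curvWeight p x ω) (dualityMap p x) η,
        x + z ∈ lpBall n p ∩ {y | 1 - η ≤ ⟪dualityMap p x, y⟫} := by
  obtain ⟨r, hr, H⟩ := abs_rpow_taylor hp (show 0 < p * ω / 2 by positivity)
  refine ⟨ω * r ^ 2 / 2, by positivity, fun x hx η hη z hz => ?_⟩
  obtain ⟨h1, h2⟩ := hz
  have hA : ∀ i, ω ≤ curvWeight p x ω i := fun i => by
    have : 0 ≤ (p - 1) * |x i| ^ (p - 2) := mul_nonneg (by linarith) (by positivity)
    unfold curvWeight; linarith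
  have hzr : ∀ i, |z i| ≤ r := by
    intro i
    have h3 : curvWeight p x ω i * z i ^ 2 ≤ ∑ i, curvWeight p x ω i * z i ^ 2 :=
      Finset.single_le_sum (f := fun i => curvWeight p x ω i * z i ^ 2)
        (fun j _ => mul_nonneg (hω.le.trans (hA j)) (sq_nonneg _)) (Finset.mem_univ i)
    have h4 : ω * z i ^ 2 ≤ curvWeight p x ω i * z i ^ 2 :=
      mul_le_mul_of_nonneg_right (hA i) (sq_nonneg _)
    have h5 : ω * z i ^ 2 ≤ ω * r ^ 2 := by linarith
    exact abs_le_of_sq_le_sq (le_of_mul_le_mul_left h5 hω) hr.le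
  refine ⟨?_, ?_⟩
  · change ∑ i, |(x + z) i| ^ p ≤ 1
    have hxB : x ∈ lpBall n p := hx.le
    have hi : ∀ i, |(x + z) i| ^ p ≤ |x i| ^ p + p * (dualityMap p x i * z i)
        + p / 2 * (curvWeight p x ω i * z i ^ 2) := by
      intro i
      have := (abs_le.1 (H (x i) (abs_le_one_of_mem_lpBall (by linarith) hxB i) (z i) (hzr i))).2
      simp only [PiLp.add_apply, dualityMap_apply, curvWeight]
      nlinarith
    calc ∑ i, |(x + z) i| ^ p ≤ ∑ i, (|x i| ^ p + p * (dualityMap p x i * z i)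
        + p / 2 * (curvWeight p x ω i * z i ^ 2)) := Finset.sum_le_sum fun i _ => hi i
      _ = 1 + p * (⟪dualityMap p x, z⟫ + (∑ i, curvWeight p x ω i * z i ^ 2) / 2) := by
        rw [Finset.sum_add_distrib, Finset.sum_add_distrib, hx, ← Finset.mul_sum, ← Finset.mul_sum,
          euc_inner_eq]
        ring
      _ ≤ 1 := by nlinarith
  · change 1 - η ≤ ⟪dualityMap p x, x + z⟫
    rw [inner_add_right, inner_dualityMap_self (by linarith), hx]
    linarith

lemma volume_le_of_translate {n : ℕ} {s t : Set (Euc n)} (x : Euc n) (h : ∀ z ∈ s, x + z ∈ t) :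
    volume s ≤ volume t := by
  rw [← measure_preimage_add volume x t]
  exact measure_mono h

/-- Uniform lower bound for the volume of caps of `lpBall`. -/
lemma le_volume_cap {m : ℕ} {p : ℝ} (hp : 2 < p) {ω : ℝ} (hω : 0 < ω) (hω1 : ω ≤ 1) :
    ∃ η₀ > 0, ∀ x : Euc (m + 1), ∑ i, |x i| ^ p = 1 → ∀ η, 0 ≤ η → η ≤ η₀ →
      ENNReal.ofReal ((2 - η * (p * ((m + 1 : ℕ) : ℝ) ^ 2)) ^ ((m : ℝ) / 2) *
        (η ^ ((m : ℝ) / 2 + 1) / ((m : ℝ) / 2 + 1)) /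
          √((diagWeight (m + 1) p + ω) ^ (m + 1) / (p - 1))) * volume (ball (0 : Euc m) 1)
      ≤ volume (lpBall (m + 1) p ∩ {y | 1 - η ≤ ⟪dualityMap p x, y⟫}) := by
  obtain ⟨η₀, hη₀, H⟩ := quadCap_subset_cap (n := m + 1) hp hω
  have hc : 0 < p * ((m + 1 : ℕ) : ℝ) ^ 2 := by positivity
  refine ⟨min η₀ (1 / (p * ((m + 1 : ℕ) : ℝ) ^ 2)), by positivity, fun x hx η h0 h1 => ?_⟩
  refine le_trans ?_ (volume_le_of_translate x (H x hx η (h1.trans (min_le_left _ _))))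
  have hA := fun i => curvWeight_pos (by linarith : 1 < p) x hω i
  have hN := le_weighted_sum (Nat.succ_pos m) hp hx hω hω1
  have hD := weighted_prod_le (Nat.succ_pos m) hp hx hω
  have hη := h1.trans (min_le_right _ _)
  set N := ∑ i, dualityMap p x i ^ 2 / curvWeight p x ω i with hNd
  have hN0 : 0 < N := lt_of_lt_of_le (by positivity) hN
  refine le_trans ?_ (le_volume_quadCap hA hN0 h0 (by rw [← hNd]; linarith))
  rw [← hNd]
  have hPA : 0 < ∏ i, curvWeight p x ω i := Finset.prod_pos fun i _ => hA i
  have h5 : η / N ≤ η * (p * ((m + 1 : ℕ) : ℝ) ^ 2) := by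
    rw [div_eq_mul_inv]
    refine mul_le_mul_of_nonneg_left ?_ h0
    rw [inv_le_comm₀ hN0 hc, ← one_div]; exact hN
  have h6 : η * (p * ((m + 1 : ℕ) : ℝ) ^ 2) ≤ 1 := by rwa [← le_div_iff₀ hc]
  have hDp : 0 < √(N * ∏ i, curvWeight p x ω i) := Real.sqrt_pos.2 (by positivity)
  have h7 : 0 ≤ (2 - η * (p * ((m + 1 : ℕ) : ℝ) ^ 2)) := by linarith
  have h8 : 0 ≤ 2 - η / N := by linarith
  gcongr

/-- The constant in the volume `capConst · η ^ ((m + 2) / 2) / √κ` of a cap of height `η`. -/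
def capConst (m : ℕ) : ℝ :=
  2 ^ ((m : ℝ) / 2) / ((m : ℝ) / 2 + 1) * (volume (ball (0 : Euc m) 1)).toReal

lemma ballVol_pos (m : ℕ) : 0 < (volume (ball (0 : Euc m) 1)).toReal :=
  ENNReal.toReal_pos (measure_ball_pos _ _ one_pos).ne' measure_ball_lt_top.ne

lemma capConst_pos (m : ℕ) : 0 < capConst m := by
  have := ballVol_pos m
  unfold capConst
  positivity

lemma tendsto_rpow_nhdsGT_zero {r : ℝ} (hr : 0 < r) :
    Tendsto (fun δ : ℝ => δ ^ r) (𝓝[>] 0) (𝓝 0) := by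
  have := (Real.continuous_rpow_const hr.le).tendsto 0
  rw [Real.zero_rpow hr.ne'] at this
  exact this.mono_left nhdsWithin_le_nhds

lemma rpow_two_div_rpow {m : ℕ} {δ : ℝ} (hδ : 0 ≤ δ) :
    (δ ^ ((2 : ℝ) / (((m + 1 : ℕ) : ℝ) + 1))) ^ ((m : ℝ) / 2 + 1) = δ := by
  rw [← Real.rpow_mul hδ]
  have : (2 : ℝ) / (((m + 1 : ℕ) : ℝ) + 1) * ((m : ℝ) / 2 + 1) = 1 := by
    have : (m : ℝ) + 2 ≠ 0 := by positivity
    push_cast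
    field_simp
    ring
  rw [this, Real.rpow_one]

lemma smul_mem_floatingBody_of_forall_cap {n : ℕ} {p q : ℝ} (hpq : p.HolderConjugate q)
    {δ η : ℝ} (hη : η ≤ 1)
    (H : ∀ x : Euc n, ∑ i, |x i| ^ p = 1 → ENNReal.ofReal δ * volume (lpBall n p) <
      volume (lpBall n p ∩ {y | 1 - η ≤ ⟪dualityMap p x, y⟫}))
    {y : Euc n} (hy : y ∈ lpBall n p) : (1 - η) • y ∈ floatingBody (lpBall n p) δ := by
  simp only [floatingBody, mem_iInter]
  intro v hv c hc
  change ⟪v, (1 - η) • y⟫ ≤ c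
  by_contra! hlt
  obtain ⟨x, M, hM, hx, rfl⟩ := exists_eq_smul_dualityMap hpq hv
  have hxy : ⟪dualityMap p x, y⟫ ≤ 1 := by
    rw [real_inner_comm]
    refine inner_le_one_of_mem_lpBall hpq hy ?_
    change ∑ i, |dualityMap p x i| ^ q ≤ 1
    rw [sum_abs_dualityMap hpq, hx]
  refine absurd (H x hx) (not_lt.2 (le_trans (measure_mono ?_) hc))
  rintro z ⟨hz1, hz2⟩
  refine ⟨hz1, ?_⟩
  change c ≤ ⟪M • dualityMap p x, z⟫
  have hz2 : 1 - η ≤ ⟪dualityMap p x, z⟫ := hz2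
  rw [real_inner_smul_left] at hlt ⊢
  rw [real_inner_smul_right] at hlt
  have h1 : (1 - η) * ⟪dualityMap p x, y⟫ ≤ ⟪dualityMap p x, z⟫ := by nlinarith
  nlinarith

/-- For small `δ`, the floating body of `lpBall` contains the ball shrunk by the critical rate. -/
lemma eventually_smul_mem_floatingBody {m : ℕ} {p : ℝ} (hp : 2 < p) {T : ℝ} (hT0 : 0 < T)
    (hT : (volume (lpBall (m + 1) p)).toReal * √(diagWeight (m + 1) p ^ (m + 1) / (p - 1))
      < capConst m * T ^ ((m : ℝ) / 2 + 1)) :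
    ∀ᶠ δ : ℝ in 𝓝[>] 0, ∀ y ∈ lpBall (m + 1) p,
      (1 - T * δ ^ ((2 : ℝ) / (((m + 1 : ℕ) : ℝ) + 1))) • y ∈ floatingBody (lpBall (m + 1) p) δ := by
  have hp1 : 0 < p - 1 := by linarith
  have ha := diagWeight_pos (Nat.succ_pos m) (by linarith : 1 < p)
  set a := diagWeight (m + 1) p with had
  set V := (volume (lpBall (m + 1) p)).toReal with hV
  set b := (volume (ball (0 : Euc m) 1)).toReal with hb
  have hb0 : 0 < b := ballVol_pos m
  set K := p * ((m + 1 : ℕ) : ℝ) ^ 2 with hK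
  set F : ℝ → ℝ → ℝ := fun ω η => (2 - η * K) ^ ((m : ℝ) / 2) *
    (T ^ ((m : ℝ) / 2 + 1) / ((m : ℝ) / 2 + 1)) / √((a + ω) ^ (m + 1) / (p - 1)) * b with hF
  have hsq : 0 < √(a ^ (m + 1) / (p - 1)) := Real.sqrt_pos.2 (by positivity)
  have hF00 : V < F 0 0 := by
    rw [← lt_div_iff₀ hsq] at hT
    refine hT.trans_eq ?_
    simp only [hF, capConst, zero_mul, sub_zero, add_zero, ← hb]
    ring
  have hF1 : ContinuousAt (fun ω => F ω 0) 0 := by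
    have : √((a + 0) ^ (m + 1) / (p - 1)) ≠ 0 := by rw [add_zero]; exact hsq.ne'
    simp only [hF]
    fun_prop (disch := assumption)
  have hev : ∀ᶠ ω : ℝ in 𝓝[>] 0, V < F ω 0 := (hF1.eventually (lt_mem_nhds hF00)).filter_mono
    nhdsWithin_le_nhds
  obtain ⟨ω, ⟨hω1, hω⟩, hω0⟩ := ((hev.and (nhdsWithin_le_nhds (Iic_mem_nhds one_pos))).and
    self_mem_nhdsWithin).exists
  have hω0 : 0 < ω := hω0
  have hF2 : ContinuousAt (fun η => F ω η) 0 := by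
    have := (Real.continuous_rpow_const (by positivity : 0 ≤ (m : ℝ) / 2))
    simp only [hF]
    fun_prop
  obtain ⟨η₀, hη₀, H⟩ := le_volume_cap (m := m) hp hω0 hω
  have hα : Tendsto (fun δ : ℝ => T * δ ^ ((2 : ℝ) / (((m + 1 : ℕ) : ℝ) + 1))) (𝓝[>] 0) (𝓝 0) := by
    simpa using (tendsto_rpow_nhdsGT_zero (by positivity)).const_mul T
  have hconj : p.HolderConjugate p.conjExponent := Real.HolderConjugate.conjExponent (by linarith)
  filter_upwards [hα.eventually (hF2.eventually (lt_mem_nhds hω1)),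
    hα.eventually (Iic_mem_nhds hη₀), hα.eventually (Iic_mem_nhds one_pos),
    self_mem_nhdsWithin] with δ h1 h2 h3 h4
  have h4 : 0 < δ := h4
  set η := T * δ ^ ((2 : ℝ) / (((m + 1 : ℕ) : ℝ) + 1)) with hη
  have hη0 : 0 < η := by positivity
  intro y hy
  refine smul_mem_floatingBody_of_forall_cap hconj h3 (fun x hx => ?_) hy
  refine lt_of_lt_of_le ?_ (H x hx η hη0.le h2)
  rw [← ENNReal.ofReal_toReal (volume_lpBall_lt_top (m + 1) (by linarith : 0 < p)).ne,
    ← ENNReal.ofReal_toReal (measure_ball_lt_top (x := (0 : Euc m)) (r := 1)).ne,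
    ← ENNReal.ofReal_mul h4.le, ← ENNReal.ofReal_mul' hb0.le, ← hV, ← hK]
  have hηp : η ^ ((m : ℝ) / 2 + 1) = T ^ ((m : ℝ) / 2 + 1) * δ := by
    rw [hη, Real.mul_rpow hT0.le (by positivity), rpow_two_div_rpow h4.le]
  rw [hηp]
  have hV0 : 0 < V := volume_lpBall_toReal_pos _ (by linarith)
  rw [ENNReal.ofReal_lt_ofReal_iff_of_nonneg (by positivity)]
  calc δ * V < δ * F ω η := by gcongr
    _ = _ := by simp only [hF]; ring

/-- The point of the `ℓ_p` sphere on the diagonal. -/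
def diagPoint (n : ℕ) (p : ℝ) : Euc n := WithLp.toLp 2 fun _ => (n : ℝ) ^ (-(1 : ℝ) / p)

lemma diagPoint_apply (n : ℕ) (p : ℝ) (i : Fin n) :
    diagPoint n p i = (n : ℝ) ^ (-(1 : ℝ) / p) := rfl

lemma sum_abs_diagPoint {n : ℕ} (hn : 0 < n) {p : ℝ} (hp : 0 < p) :
    ∑ i, |diagPoint n p i| ^ p = 1 := by
  have hn' : (0 : ℝ) < n := by exact_mod_cast hn
  simp only [diagPoint_apply, Finset.sum_const, Finset.card_univ, Fintype.card_fin, nsmul_eq_mul]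
  rw [abs_of_pos (by positivity), ← Real.rpow_mul hn'.le]
  have : -(1 : ℝ) / p * p = -1 := by field_simp
  rw [this, Real.rpow_neg_one, mul_inv_cancel₀ hn'.ne']

/-- Small caps of `lpBall` at the diagonal point lie in caps of an ellipsoid. -/
lemma cap_subset_quadCap {n : ℕ} (hn : 0 < n) {p : ℝ} (hp : 2 < p) {ω : ℝ} (hω : 0 < ω) :
    ∃ η₀ > 0, ∀ η ≤ η₀, ∀ z : Euc n,
      diagPoint n p + z ∈ lpBall n p ∩ {y | 1 - η ≤ ⟪dualityMap p (diagPoint n p), y⟫} →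
      z ∈ quadCap (fun _ => diagWeight n p - ω) (dualityMap p (diagPoint n p)) η := by
  have hn' : (0 : ℝ) < n := by exact_mod_cast hn
  obtain ⟨r, hr, H⟩ := abs_rpow_taylor hp (show 0 < p * ω / 2 by positivity)
  set w := diagPoint n p with hw
  set t : ℝ := (n : ℝ) ^ (-(1 : ℝ) / p) with ht
  have ht0 : 0 < t := by positivity
  have hwt : ∀ i, w i = t := fun i => rfl
  have hwS : ∑ i, |w i| ^ p = 1 := sum_abs_diagPoint hn (by linarith)
  have hwB : w ∈ lpBall n p := hwS.le
  refine ⟨t ^ (p - 2) * r ^ 2 / 2, by positivity, fun η hη z hz => ?_⟩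
  obtain ⟨h1, h2⟩ := hz
  have h1 : ∑ i, |(w + z) i| ^ p ≤ 1 := h1
  have h2 : 1 - η ≤ ⟪dualityMap p w, w + z⟫ := h2
  rw [inner_add_right, inner_dualityMap_self (by linarith), hwS] at h2
  have hglob : ∀ i, |w i| ^ p + p * (dualityMap p w i * z i) + p / 2 * (t ^ (p - 2) * z i ^ 2)
      ≤ |(w + z) i| ^ p := by
    intro i
    have h3 := one_add_quadratic_le_abs_rpow hp.le (z i / t)
    have h4 : |(w + z) i| ^ p = t ^ p * |1 + z i / t| ^ p := by
      rw [← abs_of_pos ht0, ← Real.mul_rpow (abs_nonneg _) (abs_nonneg _), ← abs_mul,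
        abs_of_pos ht0, PiLp.add_apply, hwt]
      congr 2; field_simp
    have h5 : t ^ p = t ^ (p - 2) * t ^ 2 := by
      rw [← Real.rpow_natCast t 2, ← Real.rpow_add ht0]; norm_num
    rw [h4, dualityMap_apply, hwt, abs_of_pos ht0]
    calc _ = t ^ p * (1 + p * (z i / t) + p / 2 * (z i / t) ^ 2) := by
          rw [h5]; field_simp
      _ ≤ _ := by gcongr
  have hs := (Finset.sum_le_sum fun i (_ : i ∈ Finset.univ) => hglob i).trans h1
  rw [Finset.sum_add_distrib, Finset.sum_add_distrib, hwS, ← Finset.mul_sum, ← Finset.mul_sum,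
    ← euc_inner_eq, ← Finset.mul_sum] at hs
  have hzr : ∀ i, |z i| ≤ r := by
    intro i
    have h3 : z i ^ 2 ≤ ∑ i, z i ^ 2 :=
      Finset.single_le_sum (f := fun i => z i ^ 2) (fun j _ => sq_nonneg _) (Finset.mem_univ i)
    have ht2 : 0 < t ^ (p - 2) := by positivity
    have h4 : t ^ (p - 2) * z i ^ 2 ≤ t ^ (p - 2) * ∑ i, z i ^ 2 := by gcongr
    have h5 : p * (t ^ (p - 2) * z i ^ 2) ≤ p * (t ^ (p - 2) * r ^ 2) := by nlinarith
    exact abs_le_of_sq_le_sq (le_of_mul_le_mul_left (le_of_mul_le_mul_left h5 (by linarith)) ht2)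
      hr.le
  have hloc : ∀ i, |w i| ^ p + p * (dualityMap p w i * z i)
      + p / 2 * ((diagWeight n p - ω) * z i ^ 2) ≤ |(w + z) i| ^ p := by
    intro i
    have := (abs_le.1 (H (w i) (abs_le_one_of_mem_lpBall (by linarith) hwB i) (z i) (hzr i))).1
    have hwa : |w i| = t := by rw [hwt, abs_of_pos ht0]
    simp only [PiLp.add_apply, dualityMap_apply, diagWeight, hwa, ← ht] at this ⊢
    nlinarith
  have hs' := (Finset.sum_le_sum fun i (_ : i ∈ Finset.univ) => hloc i).trans h1
  rw [Finset.sum_add_distrib, Finset.sum_add_distrib, hwS, ← Finset.mul_sum, ← Finset.mul_sum,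
    ← euc_inner_eq] at hs'
  refine ⟨?_, by linarith⟩
  have : p * (⟪dualityMap p w, z⟫ + (∑ i, (diagWeight n p - ω) * z i ^ 2) / 2) ≤ p * 0 := by linarith
  linarith [le_of_mul_le_mul_left this (by linarith)]

lemma sum_dualityMap_diagPoint_sq {n : ℕ} (hn : 0 < n) {p : ℝ} (hp : 1 < p) :
    ∑ i, dualityMap p (diagPoint n p) i ^ 2 = diagWeight n p / (p - 1) := by
  have hn' : (0 : ℝ) < n := by exact_mod_cast hn
  have hp1 : p - 1 ≠ 0 := by linarith
  have h := sum_abs_diagPoint hn (by linarith : 0 < p)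
  have : ∀ i, dualityMap p (diagPoint n p) i ^ 2
      = ((n : ℝ) ^ (-(1 : ℝ) / p)) ^ (p - 2) * |diagPoint n p i| ^ p := by
    intro i
    rw [dualityMap_sq hp]
    congr 2
    rw [diagPoint_apply, abs_of_pos (by positivity)]
  simp_rw [this]
  rw [← Finset.mul_sum, h, diagWeight]
  field_simp

/-- For small `δ`, the floating body of `lpBall` is cut off at the diagonal point at the critical
rate. -/
lemma eventually_floatingBody_inner_le {m : ℕ} {p : ℝ} (hp : 2 < p) {T : ℝ} (hT0 : 0 < T)
    (hT : capConst m * T ^ ((m : ℝ) / 2 + 1) <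
      (volume (lpBall (m + 1) p)).toReal * √(diagWeight (m + 1) p ^ (m + 1) / (p - 1))) :
    ∀ᶠ δ : ℝ in 𝓝[>] 0, ∀ y ∈ floatingBody (lpBall (m + 1) p) δ,
      ⟪dualityMap p (diagPoint (m + 1) p), y⟫
        ≤ 1 - T * δ ^ ((2 : ℝ) / (((m + 1 : ℕ) : ℝ) + 1)) := by
  have hp1 : 0 < p - 1 := by linarith
  have ha := diagWeight_pos (Nat.succ_pos m) (by linarith : 1 < p)
  have hv2 := sum_dualityMap_diagPoint_sq (Nat.succ_pos m) (by linarith : 1 < p)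
  have hwS := sum_abs_diagPoint (Nat.succ_pos m) (by linarith : 0 < p)
  set w := diagPoint (m + 1) p with hw
  set a := diagWeight (m + 1) p with had
  set V := (volume (lpBall (m + 1) p)).toReal with hV
  set b := (volume (ball (0 : Euc m) 1)).toReal with hb
  have hb0 : 0 < b := ballVol_pos m
  set F : ℝ → ℝ := fun ω => 2 ^ ((m : ℝ) / 2) *
    (T ^ ((m : ℝ) / 2 + 1) / ((m : ℝ) / 2 + 1)) / √(a * (a - ω) ^ m / (p - 1)) * b with hF
  have hsq : 0 < √(a ^ (m + 1) / (p - 1)) := Real.sqrt_pos.2 (by positivity)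
  have hsq' : 0 < √(a * (a - 0) ^ m / (p - 1)) := by
    rw [sub_zero, ← pow_succ']; exact hsq
  have hF0 : F 0 < V := by
    rw [← div_lt_iff₀ hsq] at hT
    refine lt_of_eq_of_lt ?_ hT
    simp only [hF, capConst, sub_zero, ← hb, ← pow_succ']
    ring
  have hFc : ContinuousAt F 0 := by
    have := hsq'.ne'
    simp only [hF]
    fun_prop (disch := assumption)
  have hev : ∀ᶠ ω : ℝ in 𝓝[>] 0, F ω < V := (hFc.eventually (gt_mem_nhds hF0)).filter_mono
    nhdsWithin_le_nhds
  obtain ⟨ω, ⟨hω1, hω⟩, hω0⟩ := ((hev.and (nhdsWithin_le_nhds (gt_mem_nhds ha))).and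
    self_mem_nhdsWithin).exists
  have hω0 : 0 < ω := hω0
  have hω : ω < a := hω
  have haω : 0 < a - ω := by linarith
  obtain ⟨η₀, hη₀, H⟩ := cap_subset_quadCap (Nat.succ_pos m) hp hω0
  have hα : Tendsto (fun δ : ℝ => T * δ ^ ((2 : ℝ) / (((m + 1 : ℕ) : ℝ) + 1))) (𝓝[>] 0) (𝓝 0) := by
    simpa using (tendsto_rpow_nhdsGT_zero (by positivity)).const_mul T
  filter_upwards [hα.eventually (Iic_mem_nhds hη₀), self_mem_nhdsWithin] with δ h2 h4
  have h4 : 0 < δ := h4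
  set η := T * δ ^ ((2 : ℝ) / (((m + 1 : ℕ) : ℝ) + 1)) with hη
  have hη0 : 0 < η := by positivity
  intro y hy
  simp only [floatingBody, mem_iInter] at hy
  refine hy (dualityMap p w) ?_ (1 - η) ?_
  · intro h0
    have := inner_dualityMap_self (by linarith : 1 < p) w
    rw [h0, inner_zero_left, hwS] at this
    exact zero_ne_one this
  rw [← measure_preimage_add volume w]
  refine (measure_mono (fun z hz => H η h2 z hz)).trans ?_
  have hN : ∑ i, dualityMap p w i ^ 2 / (a - ω) = a / (p - 1) / (a - ω) := by
    rw [← Finset.sum_div, hv2]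
  refine (volume_quadCap_le (fun _ => haω) (by rw [hN]; positivity) hη0.le).trans ?_
  rw [hN, Finset.prod_const, Finset.card_univ, Fintype.card_fin,
    ← ENNReal.ofReal_toReal (volume_lpBall_lt_top (m + 1) (by linarith : 0 < p)).ne,
    ← ENNReal.ofReal_toReal (measure_ball_lt_top (x := (0 : Euc m)) (r := 1)).ne,
    ← ENNReal.ofReal_mul h4.le, ← ENNReal.ofReal_mul' hb0.le, ← hV]
  have hηp : η ^ ((m : ℝ) / 2 + 1) = T ^ ((m : ℝ) / 2 + 1) * δ := by
    rw [hη, Real.mul_rpow hT0.le (by positivity), rpow_two_div_rpow h4.le]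
  have hD : a / (p - 1) / (a - ω) * (a - ω) ^ (m + 1) = a * (a - ω) ^ m / (p - 1) := by
    rw [pow_succ]; field_simp
  rw [hηp, hD]
  apply ENNReal.ofReal_le_ofReal
  calc _ = δ * F ω := by simp only [hF]; ring
    _ ≤ δ * V := by gcongr

section Illumination

variable {n : ℕ} {Q : Set (Euc n)} {y : Euc n} {δ : ℝ}

lemma volume_le_of_mem_illuminationBody (hQm : MeasurableSet Q) (hQf : volume Q ≠ ⊤) (hδ : 0 ≤ δ)
    (hy : y ∈ illuminationBody Q δ) {D : Set (Euc n)} (hD : D ⊆ convexHull ℝ (Q ∪ {y}))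
    (hd : Disjoint D Q) : volume D ≤ ENNReal.ofReal δ * volume Q := by
  have h1 : volume D + volume Q ≤ ENNReal.ofReal (1 + δ) * volume Q := by
    rw [← measure_union hd hQm]
    exact (measure_mono (union_subset hD (subset_union_left.trans (subset_convexHull ℝ _)))).trans
      hy
  rw [ENNReal.ofReal_add zero_le_one hδ, add_mul, ENNReal.ofReal_one, one_mul, add_comm] at h1
  exact (ENNReal.add_le_add_iff_left hQf).1 h1

lemma mem_illuminationBody_of_volume_sdiff_le (hδ : 0 ≤ δ)
    (h : volume (convexHull ℝ (Q ∪ {y}) \ Q) ≤ ENNReal.ofReal δ * volume Q) :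
    y ∈ illuminationBody Q δ := by
  change volume _ ≤ _
  rw [ENNReal.ofReal_add zero_le_one hδ, add_mul, ENNReal.ofReal_one, one_mul]
  calc _ ≤ volume (Q ∪ convexHull ℝ (Q ∪ {y}) \ Q) := measure_mono (by
        rw [union_sdiff_self]; exact subset_union_right)
    _ ≤ _ := (measure_union_le _ _).trans (by gcongr)

lemma combo_mem_convexHull_union {z : Euc n} {a b : ℝ} (hz : z ∈ Q) (ha : 0 ≤ a) (hb : 0 ≤ b)
    (hab : a + b = 1) : a • y + b • z ∈ convexHull ℝ (Q ∪ {y}) :=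
  convex_convexHull ℝ _ (subset_convexHull ℝ (Q ∪ {y}) (Or.inr rfl))
    (subset_convexHull ℝ (Q ∪ {y}) (Or.inl hz)) ha hb hab

/-- A point of an illumination body at level `1 + σ` above a supporting hyperplane forces the
opposite cap of height `σ` to be small. -/
lemma volume_cap_le_of_mem_illuminationBody (hQm : MeasurableSet Q) (hQf : volume Q ≠ ⊤)
    (hδ : 0 ≤ δ) (hy : y ∈ illuminationBody Q δ) {x : Euc n} (hx : ∀ z ∈ Q, ⟪x, z⟫ ≤ 1) {σ : ℝ}
    (hσ : 0 < σ) (hxy : 1 + σ ≤ ⟪x, y⟫) :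
    ENNReal.ofReal ((1 / 4) ^ n) * volume (Q ∩ {z | 1 - σ ≤ ⟪x, z⟫})
      ≤ ENNReal.ofReal δ * volume Q := by
  set C := Q ∩ {z | 1 - σ ≤ ⟪x, z⟫} with hC
  have h1 : volume ((1 / 4 : ℝ) • C) = ENNReal.ofReal ((1 / 4) ^ n) * volume C := by
    rw [Measure.addHaar_smul, finrank_euclideanSpace, Fintype.card_fin, abs_of_pos (by positivity)]
  rw [← h1]
  refine (volume_le_of_translate ((3 / 4 : ℝ) • y) (t := convexHull ℝ (Q ∪ {y}) ∩ {z | 1 < ⟪x, z⟫})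
    ?_).trans (volume_le_of_mem_illuminationBody hQm hQf hδ hy inter_subset_left ?_)
  · rintro _ ⟨z, ⟨hz1, hz2⟩, rfl⟩
    refine ⟨combo_mem_convexHull_union hz1 (by norm_num) (by norm_num) (by norm_num), ?_⟩
    have hz2 : 1 - σ ≤ ⟪x, z⟫ := hz2
    change 1 < ⟪x, (3 / 4 : ℝ) • y + (1 / 4 : ℝ) • z⟫
    rw [inner_add_right, real_inner_smul_right, real_inner_smul_right]
    linarith
  · rw [Set.disjoint_left]
    rintro z ⟨_, hz⟩ hzQ
    exact absurd (hx z hzQ) (not_le.2 hz)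

lemma det_half_add_inner (x y : Euc n) :
    LinearMap.det ((1 / 2 : ℝ) • LinearMap.transvection (innerₛₗ ℝ x) y)
      = (1 / 2) ^ n * (1 + ⟪x, y⟫) := by
  rw [LinearMap.det_smul, LinearMap.transvection.det, finrank_euclideanSpace, Fintype.card_fin]
  rfl

lemma inner_le_of_mem_illuminationBody (hQf : volume Q ≠ ⊤) (hQ0 : volume Q ≠ 0)
    (h0 : (0 : Euc n) ∈ Q) (hneg : ∀ z ∈ Q, -z ∈ Q) (hδ : 0 ≤ δ)
    (hy : y ∈ illuminationBody Q δ) {x : Euc n} (hx : ∀ z ∈ Q, ⟪x, z⟫ ≤ 1) :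
    ⟪x, y⟫ ≤ 2 ^ (n + 1) * (1 + δ) := by
  set C := Q ∩ {z | 0 ≤ ⟪x, z⟫} with hC
  have hhalf : volume Q ≤ 2 * volume C := by
    have : Q ⊆ C ∪ -C := by
      intro z hz
      rcases le_total 0 ⟪x, z⟫ with h | h
      · exact Or.inl ⟨hz, h⟩
      · refine Or.inr ⟨hneg z hz, ?_⟩
        change 0 ≤ ⟪x, -z⟫
        rw [inner_neg_right]; linarith
    refine (measure_mono this).trans ((measure_union_le _ _).trans_eq ?_)
    rw [Measure.measure_neg, two_mul]
  set A := (1 / 2 : ℝ) • LinearMap.transvection (innerₛₗ ℝ x) y with hA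
  have himg : A '' C ⊆ convexHull ℝ (Q ∪ {y}) := by
    rintro _ ⟨z, ⟨hz1, hz2⟩, rfl⟩
    have hz2 : 0 ≤ ⟪x, z⟫ := hz2
    have e : A z = (1 / 2 : ℝ) • z + (1 / 2 : ℝ) • (⟪x, z⟫ • y + (1 - ⟪x, z⟫) • (0 : Euc n)) := by
      simp [hA, LinearMap.transvection.apply]
    rw [e]
    exact convex_convexHull ℝ _ (subset_convexHull ℝ (Q ∪ {y}) (Or.inl hz1))
      (combo_mem_convexHull_union h0 hz2 (by linarith [hx z hz1]) (by ring)) (by norm_num)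
      (by norm_num) (by norm_num)
  by_contra! hlt
  have hpos : 0 < ⟪x, y⟫ := lt_of_le_of_lt (by positivity) hlt
  have h1 : ENNReal.ofReal ((1 / 2) ^ n * (1 + ⟪x, y⟫)) * volume C
      ≤ ENNReal.ofReal (1 + δ) * volume Q := by
    have := (measure_mono himg).trans hy
    rwa [Measure.addHaar_image_linearMap, det_half_add_inner, abs_of_pos (by positivity)] at this
  have h2 : ENNReal.ofReal ((1 / 2) ^ n * (1 + ⟪x, y⟫)) * volume Q
      ≤ ENNReal.ofReal (2 * (1 + δ)) * volume Q := by
    calc _ ≤ ENNReal.ofReal ((1 / 2) ^ n * (1 + ⟪x, y⟫)) * (2 * volume C) := by gcongr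
      _ = 2 * (ENNReal.ofReal ((1 / 2) ^ n * (1 + ⟪x, y⟫)) * volume C) := by ring
      _ ≤ 2 * (ENNReal.ofReal (1 + δ) * volume Q) := by gcongr
      _ = _ := by
        rw [ENNReal.ofReal_mul zero_le_two, ENNReal.ofReal_ofNat, mul_assoc]
  have h3 := (ENNReal.ofReal_le_ofReal_iff (by positivity)).1
    ((ENNReal.mul_le_mul_iff_left hQ0 hQf).1 h2)
  have h4 : (2 : ℝ) ^ n * ((1 / 2) ^ n * (1 + ⟪x, y⟫)) ≤ 2 ^ n * (2 * (1 + δ)) := by gcongr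
  rw [← mul_assoc, ← mul_pow, mul_one_div_cancel two_ne_zero, one_pow, one_mul, ← mul_assoc,
    ← pow_succ] at h4
  linarith

end Illumination

section DualBall

variable {n : ℕ} {p q : ℝ}

/-- The illumination bodies of a dual ball shrink to that ball. -/
lemma exists_illuminationBody_inner_le (hpq : p.HolderConjugate q) {s : ℝ} (hs : 0 < s) :
    ∃ δ > 0, ∀ y ∈ illuminationBody (lpBall n q) δ, ∀ x ∈ lpBall n p, ⟪x, y⟫ ≤ 1 + s := by
  have hq := hpq.symm.lt
  set τ := min (s / 2) 1 with hτ
  have hτ0 : 0 < τ := by positivity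
  have hτs : τ ≤ s / 2 := min_le_left _ _
  have hτ1 : τ ≤ 1 := min_le_right _ _
  refine ⟨(1 / 4) ^ n * τ ^ n / 2, by positivity, fun y hy x hx => ?_⟩
  by_contra! hlt
  have hx0 : x ≠ 0 := by
    rintro rfl
    rw [inner_zero_left] at hlt; linarith
  obtain ⟨v, M, hM, hv, rfl⟩ := exists_eq_smul_dualityMap hpq.symm hx0
  have hvQ : v ∈ lpBall n q := hv.le
  have hM1 : M ≤ 1 := by
    have := inner_le_one_of_mem_lpBall hpq hx hvQ
    rwa [real_inner_smul_left, inner_dualityMap_self hq, hv, mul_one] at this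
  have hgB : dualityMap q v ∈ lpBall n p := by
    change ∑ i, |dualityMap q v i| ^ p ≤ 1
    rw [sum_abs_dualityMap hpq.symm, hv]
  rw [real_inner_smul_left] at hlt
  have hlt' : 1 + s ≤ ⟪dualityMap q v, y⟫ := by
    have h1 : 0 < M * ⟪dualityMap q v, y⟫ := by linarith
    have h2 : 0 < ⟪dualityMap q v, y⟫ := (mul_pos_iff_of_pos_left hM).1 h1
    nlinarith
  have hpos := volume_lpBall_pos n (by linarith : 0 < q)
  have hfin := (volume_lpBall_lt_top n (by linarith : 0 < q)).ne
  have h1 := volume_cap_le_of_mem_illuminationBody (isClosed_lpBall n (by linarith)).measurableSet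
    hfin (by positivity) hy (fun z hz => inner_le_one_of_mem_lpBall hpq hgB hz) hs hlt'
  have h2 : volume (τ • lpBall n q)
      ≤ volume (lpBall n q ∩ {z | 1 - s ≤ ⟪dualityMap q v, z⟫}) := by
    refine volume_le_of_translate ((1 - τ) • v) ?_
    rintro _ ⟨z, hz, rfl⟩
    refine ⟨convex_lpBall n hq.le hvQ hz (by linarith) hτ0.le (by ring), ?_⟩
    change 1 - s ≤ ⟪dualityMap q v, (1 - τ) • v + τ • z⟫
    rw [inner_add_right, real_inner_smul_right, real_inner_smul_right, inner_dualityMap_self hq, hv]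
    have := inner_le_one_of_mem_lpBall hpq hgB (neg_mem_lpBall hz)
    rw [inner_neg_right] at this
    nlinarith
  rw [Measure.addHaar_smul, finrank_euclideanSpace, Fintype.card_fin,
    abs_of_pos (by positivity)] at h2
  have h3 : ENNReal.ofReal ((1 / 4) ^ n * τ ^ n) * volume (lpBall n q)
      ≤ ENNReal.ofReal ((1 / 4) ^ n * τ ^ n / 2) * volume (lpBall n q) := by
    refine le_trans ?_ h1
    rw [ENNReal.ofReal_mul (by positivity), mul_assoc]
    gcongr
  have h4 := (ENNReal.ofReal_le_ofReal_iff (by positivity)).1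
    ((ENNReal.mul_le_mul_iff_left hpos.ne' hfin).1 h3)
  have h5 : (0 : ℝ) < (1 / 4) ^ n * τ ^ n := by positivity
  linarith

/-- Caps of `ℓ_q` balls, `q ≤ 2`, at points off the coordinate hyperplanes have at least quadratic
width. -/
lemma exists_le_volume_cap {m : ℕ} (hq1 : 1 < q) (hq2 : q ≤ 2) {v : Euc (m + 1)}
    (hv : ∑ i, |v i| ^ q = 1) (hv0 : ∀ i, v i ≠ 0) :
    ∃ c > 0, ∃ σ₀ > 0, ∀ σ, 0 ≤ σ → σ ≤ σ₀ → ENNReal.ofReal (c * σ ^ ((m : ℝ) / 2 + 1))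
      ≤ volume (lpBall (m + 1) q ∩ {z | 1 - σ ≤ ⟪dualityMap q v, z⟫}) := by
  set A : Fin (m + 1) → ℝ := fun i => |v i| ^ (q - 2) with hA
  have hA0 : ∀ i, 0 < A i := fun i => Real.rpow_pos_of_pos (abs_pos.2 (hv0 i)) _
  have hg0 : ∀ i, dualityMap q v i ≠ 0 := fun i => by
    rw [dualityMap_apply]; exact mul_ne_zero (hA0 i).ne' (hv0 i)
  set N := ∑ i, dualityMap q v i ^ 2 / A i with hN
  have hN0 : 0 < N := Finset.sum_pos (fun i _ => by
    have := hA0 i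
    have := hg0 i
    positivity) Finset.univ_nonempty
  have hb := ballVol_pos m
  have hD : 0 < √(N * ∏ i, A i) :=
    Real.sqrt_pos.2 (mul_pos hN0 (Finset.prod_pos fun i _ => hA0 i))
  refine ⟨1 / ((m : ℝ) / 2 + 1) / √(N * ∏ i, A i) * (volume (ball (0 : Euc m) 1)).toReal,
    by positivity, N, hN0, fun σ h0 h1 => ?_⟩
  refine le_trans ?_ ((le_volume_quadCap hA0 hN0 h0 (by linarith)).trans
    (volume_le_of_translate v ?_))
  · rw [← ENNReal.ofReal_toReal (measure_ball_lt_top (x := (0 : Euc m)) (r := 1)).ne,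
      ← ENNReal.ofReal_mul' hb.le]
    apply ENNReal.ofReal_le_ofReal
    have h2 : 1 ≤ (2 - σ / N) ^ ((m : ℝ) / 2) := by
      apply Real.one_le_rpow _ (by positivity)
      have : σ / N ≤ 1 := by rwa [div_le_one hN0]
      linarith
    rw [ENNReal.toReal_ofReal hb.le]
    calc _ = 1 * (σ ^ ((m : ℝ) / 2 + 1) / ((m : ℝ) / 2 + 1)) / √(N * ∏ i, A i)
          * (volume (ball (0 : Euc m) 1)).toReal := by ring
      _ ≤ _ := by gcongr
  · rintro z ⟨hz1, hz2⟩
    constructor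
    · change ∑ i, |(v + z) i| ^ q ≤ 1
      have hi : ∀ i, |(v + z) i| ^ q
          ≤ |v i| ^ q + q * (dualityMap q v i * z i) + q / 2 * (A i * z i ^ 2) := by
        intro i
        have h3 := abs_rpow_le_one_add_quadratic (by linarith) hq2 (z i / v i)
        have h4 : |(v + z) i| ^ q = |v i| ^ q * |1 + z i / v i| ^ q := by
          rw [← Real.mul_rpow (abs_nonneg _) (abs_nonneg _), ← abs_mul, PiLp.add_apply]
          congr 2
          have := hv0 i
          field_simp
        rw [h4]
        calc _ ≤ |v i| ^ q * (1 + q * (z i / v i) + q / 2 * (z i / v i) ^ 2) := by gcongr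
          _ = _ := by
            rw [dualityMap_apply, ← abs_rpow_mul_sq hq1]
            have := hv0 i
            simp only [hA]
            field_simp
      refine (Finset.sum_le_sum fun i _ => hi i).trans ?_
      rw [Finset.sum_add_distrib, Finset.sum_add_distrib, hv, ← Finset.mul_sum, ← Finset.mul_sum,
        ← euc_inner_eq]
      nlinarith
    · change 1 - σ ≤ ⟪dualityMap q v, v + z⟫
      rw [inner_add_right, inner_dualityMap_self hq1, hv]
      linarith

end DualBall

/-- The part of a cone over an `ℓ_q` ball with apex near `e₀` lying outside the ball is contained
in a small box. -/
lemma abs_le_of_mem_convexHull_sdiff {m : ℕ} {q : ℝ} (hq1 : 1 < q) (hq2 : q ≤ 2) {s : ℝ}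
    (hs : 0 < s) (hs1 : s ≤ 1) {z : Euc (m + 1)}
    (hz : z ∈ convexHull ℝ (lpBall (m + 1) q ∪ {(1 + s) • EuclideanSpace.single 0 1}))
    (hzQ : z ∉ lpBall (m + 1) q) :
    |z 0| ≤ 1 + s ∧ 1 - 3 * s / (q - 1) ≤ |z 0| ∧ ∀ i : Fin m, |z i.succ| ^ q ≤ 3 * s / (q - 1) := by
  have hqm : 0 < q - 1 := by linarith
  have h0 := zero_mem_lpBall (m + 1) (by linarith : 0 < q)
  rw [union_comm, singleton_union, convexHull_insert ⟨0, h0⟩,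
    (convex_lpBall (m + 1) hq1.le).convexHull_eq, convexJoin_singleton_left, mem_iUnion₂] at hz
  obtain ⟨y, hy, μ, l, hμ, hl, hμl, rfl⟩ := hz
  set e : Euc (m + 1) := EuclideanSpace.single 0 1 with he
  have hl1 : l < 1 := by
    rcases hμ.lt_or_eq with h | h
    · linarith
    · refine absurd ?_ hzQ
      rw [← h, zero_smul, zero_add, show l = 1 by linarith, one_smul]
      exact hy
  have hz0 : (μ • (1 + s) • e + l • y) 0 = μ * (1 + s) + l * y 0 := by simp [he]
  have hzi : ∀ i : Fin m, (μ • (1 + s) • e + l • y) i.succ = l * y i.succ := by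
    intro i; simp [he, Fin.succ_ne_zero]
  have hy' : |y 0| ^ q + ∑ i : Fin m, |y i.succ| ^ q ≤ 1 := by
    have := show ∑ i, |y i| ^ q ≤ 1 from hy
    rwa [Fin.sum_univ_succ] at this
  set ρ := ∑ i : Fin m, |y i.succ| ^ q with hρ
  have hρ0 : 0 ≤ ρ := Finset.sum_nonneg fun i _ => by positivity
  have hy0 : |y 0| ≤ 1 := abs_le_one_of_mem_lpBall (by linarith) hy 0
  have hout : 1 < |μ * (1 + s) + l * y 0| ^ q + l ^ q * ρ := by
    have h1 : ¬ ∑ i, |(μ • (1 + s) • e + l • y) i| ^ q ≤ 1 := hzQ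
    rw [not_le, Fin.sum_univ_succ, hz0] at h1
    simp only [hzi, abs_mul, abs_of_nonneg hl, Real.mul_rpow hl (abs_nonneg _)] at h1
    rwa [← Finset.mul_sum] at h1
  have habs : |μ * (1 + s) + l * y 0| ≤ μ * (1 + s) + l * |y 0| := by
    refine (abs_add_le _ _).trans ?_
    rw [abs_mul, abs_mul, abs_of_nonneg hμ, abs_of_nonneg hl, abs_of_pos (by linarith : 0 < 1 + s)]
  have hconv : |μ * (1 + s) + l * y 0| ^ q ≤ μ * (1 + s) ^ q + l * |y 0| ^ q := by
    have h1 := (convexOn_rpow hq1.le).2 (show 1 + s ∈ Ici (0 : ℝ) from by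
      change 0 ≤ 1 + s; linarith) (abs_nonneg (y 0)) hμ hl hμl
    simp only [smul_eq_mul] at h1
    exact (Real.rpow_le_rpow (abs_nonneg _) habs (by linarith)).trans h1
  have hs3 : (1 + s) ^ q ≤ 1 + 3 * s := by
    calc (1 + s) ^ q ≤ (1 + s) ^ (2 : ℝ) := Real.rpow_le_rpow_of_exponent_le (by linarith) hq2
      _ = (1 + s) ^ 2 := by norm_cast
      _ ≤ 1 + 3 * s := by nlinarith
  have hbern : l ^ q ≤ l * (1 - (q - 1) * (1 - l)) := by
    have h1 := rpow_one_add_le_one_add_mul_self (s := l - 1) (by linarith) hqm.le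
      (by linarith : q - 1 ≤ 1)
    rw [add_sub_cancel] at h1
    calc l ^ q = l * l ^ (q - 1) := by
          conv_rhs => rw [← Real.rpow_one_add' hl (by linarith), add_sub_cancel]
      _ ≤ l * (1 - (q - 1) * (1 - l)) := by gcongr; linarith
  have hlρ : l * ρ ≤ 3 * s / (q - 1) := by
    rw [le_div_iff₀ hqm]
    have h1 : l ^ q * ρ ≤ l * (1 - (q - 1) * (1 - l)) * ρ := by gcongr
    have h2 : μ * (1 + s) ^ q ≤ μ * (1 + 3 * s) := by gcongr
    have h3 : l * |y 0| ^ q ≤ l * (1 - ρ) := by gcongr; linarith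
    have hμ' : μ = 1 - l := by linarith
    have h4 : (1 - l) * (l * ρ * (q - 1)) ≤ (1 - l) * (3 * s) := by
      have h5 := hout.trans_le (add_le_add hconv h1)
      rw [hμ'] at h2 h5
      linarith
    exact le_of_mul_le_mul_left h4 (by linarith)
  have hlq : l ^ q * ρ ≤ 3 * s / (q - 1) := by
    refine le_trans ?_ hlρ
    gcongr
    calc l ^ q ≤ l ^ (1 : ℝ) := Real.rpow_le_rpow_of_exponent_ge_of_imp hl hl1.le hq1.le
          (by intros; linarith)
      _ = l := Real.rpow_one l
  rw [hz0]
  refine ⟨habs.trans (by nlinarith), ?_, fun i => ?_⟩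
  · rcases le_total 1 |μ * (1 + s) + l * y 0| with h | h
    · have : 0 ≤ 3 * s / (q - 1) := by positivity
      linarith
    · have h1 : |μ * (1 + s) + l * y 0| ^ q ≤ |μ * (1 + s) + l * y 0| ^ (1 : ℝ) :=
        Real.rpow_le_rpow_of_exponent_ge_of_imp (abs_nonneg _) h hq1.le (by intros; linarith)
      rw [Real.rpow_one] at h1
      linarith
  · rw [hzi, abs_mul, abs_of_nonneg hl, Real.mul_rpow hl (abs_nonneg _)]
    refine le_trans ?_ hlq
    gcongr
    exact Finset.single_le_sum (f := fun j : Fin m => |y j.succ| ^ q) (fun j _ => by positivity)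
      (Finset.mem_univ i)

lemma volume_box_le {m : ℕ} {a b R : ℝ} (hab : a ≤ b) (hR : 0 ≤ R) :
    volume {z : Euc (m + 1) | |z 0| ≤ b ∧ a ≤ |z 0| ∧ ∀ i : Fin m, |z i.succ| ≤ R}
      ≤ ENNReal.ofReal (2 * (b - a) * (2 * R) ^ m) := by
  rw [euc_volume_eq]
  set S : Fin (m + 1) → Set ℝ := Fin.cons (Icc a b ∪ Icc (-b) (-a)) (fun _ => Icc (-R) R) with hS
  have hsub : ((fun x : Fin (m + 1) → ℝ => (WithLp.toLp 2 x : Euc (m + 1))) ⁻¹'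
      {z : Euc (m + 1) | |z 0| ≤ b ∧ a ≤ |z 0| ∧ ∀ i : Fin m, |z i.succ| ≤ R})
      ⊆ Set.univ.pi S := by
    rintro z ⟨h1, h2, h3⟩ i -
    refine Fin.cases ?_ (fun j => ?_) i
    · simp only [hS, Fin.cons_zero]
      have h1 : |z 0| ≤ b := h1
      have h2 : a ≤ |z 0| := h2
      rcases le_total 0 (z 0) with h | h
      · rw [abs_of_nonneg h] at h1 h2
        exact Or.inl ⟨h2, h1⟩
      · rw [abs_of_nonpos h] at h1 h2
        exact Or.inr ⟨by linarith, by linarith⟩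
    · simp only [hS, Fin.cons_succ]
      exact abs_le.1 (h3 j)
  refine (measure_mono hsub).trans ?_
  rw [volume_pi_pi, Fin.prod_univ_succ]
  simp only [hS, Fin.cons_zero, Fin.cons_succ, Real.volume_Icc, Finset.prod_const,
    Finset.card_univ, Fintype.card_fin]
  rw [ENNReal.ofReal_mul (by linarith), ENNReal.ofReal_pow (by positivity)]
  gcongr
  · refine (measure_union_le _ _).trans_eq ?_
    rw [Real.volume_Icc, Real.volume_Icc, ← ENNReal.ofReal_add (by linarith) (by linarith)]
    congr 1; ring
  · linarith

lemma exists_volume_convexHull_sdiff_le {m : ℕ} {q : ℝ} (hq1 : 1 < q) (hq2 : q ≤ 2) :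
    ∃ K > 0, ∀ s, 0 < s → s ≤ 1 →
      volume (convexHull ℝ (lpBall (m + 1) q ∪ {(1 + s) • EuclideanSpace.single 0 1})
        \ lpBall (m + 1) q) ≤ ENNReal.ofReal (K * s ^ (1 + (m : ℝ) / q)) := by
  have hqm : 0 < q - 1 := by linarith
  set C := 3 / (q - 1) with hC
  have hC0 : 0 < C := by positivity
  refine ⟨2 * (1 + C) * (2 * C ^ (1 / q)) ^ m, by positivity, fun s hs hs1 => ?_⟩
  have h1 : volume (convexHull ℝ (lpBall (m + 1) q ∪ {(1 + s) • EuclideanSpace.single 0 1})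
        \ lpBall (m + 1) q) ≤ volume {z : Euc (m + 1) | |z 0| ≤ 1 + s ∧ 1 - C * s ≤ |z 0| ∧
          ∀ i : Fin m, |z i.succ| ≤ (C * s) ^ (1 / q)} := by
    refine measure_mono fun z hz => ?_
    obtain ⟨h1, h2, h3⟩ := abs_le_of_mem_convexHull_sdiff hq1 hq2 hs hs1 hz.1 hz.2
    have e : 3 * s / (q - 1) = C * s := by rw [hC]; ring
    rw [e] at h2
    simp only [e] at h3
    refine ⟨h1, h2, fun i => ?_⟩
    rw [one_div, Real.le_rpow_inv_iff_of_pos (abs_nonneg _) (by positivity) (by linarith)]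
    exact h3 i
  refine h1.trans ((volume_box_le (by nlinarith) (by positivity)).trans_eq ?_)
  congr 1
  rw [Real.mul_rpow hC0.le hs.le, Real.rpow_add hs, Real.rpow_one, div_eq_mul_one_div (m : ℝ) q,
    mul_comm (m : ℝ), Real.rpow_mul hs.le, Real.rpow_natCast, mul_pow, mul_pow, mul_pow]
  ring

/-- If an illumination body of the `ℓ_q` ball, `q < 2`, sticks out by `σ` in a direction off the
coordinate hyperplanes, then it sticks out by much more than `σ` in the coordinate direction. -/
lemma exists_smul_single_mem_illuminationBody {m : ℕ} (hm : m ≠ 0) {p q : ℝ}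
    (hpq : p.HolderConjugate q) (hq2 : q < 2) {v : Euc (m + 1)}
    (hv : ∑ i, |v i| ^ q = 1) (hv0 : ∀ i, v i ≠ 0) {N : ℝ} (hN : 0 < N) :
    ∃ σ₀ > 0, ∀ σ, 0 < σ → σ ≤ σ₀ → ∀ δ, 0 ≤ δ → ∀ y ∈ illuminationBody (lpBall (m + 1) q) δ,
      1 + σ ≤ ⟪dualityMap q v, y⟫ →
      (1 + N * σ) • EuclideanSpace.single 0 1 ∈ illuminationBody (lpBall (m + 1) q) δ := by
  have hq1 := hpq.symm.lt
  obtain ⟨c, hc, σ₁, hσ₁, H1⟩ := exists_le_volume_cap hq1 hq2.le hv hv0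
  obtain ⟨K, hK, H2⟩ := exists_volume_convexHull_sdiff_le (m := m) hq1 hq2.le
  have hm0 : (0 : ℝ) < m := by exact_mod_cast Nat.pos_of_ne_zero hm
  have hexp : 0 < (m : ℝ) / q - m / 2 := by
    rw [sub_pos]; gcongr
  have hlim := (tendsto_rpow_nhdsGT_zero hexp).const_mul (K * N ^ (1 + (m : ℝ) / q))
  rw [mul_zero] at hlim
  have hev := hlim.eventually (Iic_mem_nhds (show (0 : ℝ) < (1 / 4) ^ (m + 1) * c by positivity))
  obtain ⟨σ₂, hσ₂, H3⟩ := mem_nhdsGT_iff_exists_Ioc_subset.1 hev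
  have hσ₂ : 0 < σ₂ := hσ₂
  refine ⟨min σ₁ (min σ₂ (1 / N)), by positivity, fun σ h0 h1 δ hδ y hy hvy => ?_⟩
  have h11 : σ ≤ σ₁ := h1.trans (min_le_left _ _)
  have h12 : σ ≤ σ₂ := h1.trans ((min_le_right _ _).trans (min_le_left _ _))
  have h13 : N * σ ≤ 1 := by
    rw [← le_div_iff₀' hN]
    exact h1.trans ((min_le_right _ _).trans (min_le_right _ _))
  have hgB : dualityMap q v ∈ lpBall (m + 1) p := by
    change ∑ i, |dualityMap q v i| ^ p ≤ 1
    rw [sum_abs_dualityMap hpq.symm, hv]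
  have h2 := volume_cap_le_of_mem_illuminationBody
    (isClosed_lpBall (m + 1) (by linarith)).measurableSet
    (volume_lpBall_lt_top (m + 1) (by linarith)).ne hδ hy
    (fun z hz => inner_le_one_of_mem_lpBall hpq hgB hz) h0 hvy
  refine mem_illuminationBody_of_volume_sdiff_le hδ
    ((H2 (N * σ) (by positivity) h13).trans (le_trans ?_ h2))
  refine le_trans ?_ (mul_le_mul_right (H1 σ h0.le h11) _)
  rw [← ENNReal.ofReal_mul (by positivity)]
  apply ENNReal.ofReal_le_ofReal
  have h3 : K * N ^ (1 + (m : ℝ) / q) * σ ^ ((m : ℝ) / q - m / 2) ≤ (1 / 4) ^ (m + 1) * c :=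
    H3 ⟨h0, h12⟩
  calc K * (N * σ) ^ (1 + (m : ℝ) / q)
      = K * N ^ (1 + (m : ℝ) / q) * σ ^ ((m : ℝ) / q - m / 2) * σ ^ ((m : ℝ) / 2 + 1) := by
        rw [Real.mul_rpow hN.le h0.le, mul_assoc _ (σ ^ _) (σ ^ _), ← Real.rpow_add h0, mul_assoc]
        congr 3; ring
    _ ≤ (1 / 4) ^ (m + 1) * c * σ ^ ((m : ℝ) / 2 + 1) := by gcongr
    _ = _ := by ring

section Distance

variable {n : ℕ} {p q : ℝ}

lemma floatingBody_lpBall_subset (hpq : p.HolderConjugate q) (δ : ℝ) :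
    floatingBody (lpBall n p) δ ⊆ lpBall n p := by
  intro x hx
  rw [← polarBody_lpBall n hpq.symm]
  intro v hv
  simp only [floatingBody, mem_iInter] at hx
  rcases eq_or_ne v 0 with rfl | hv0
  · rw [inner_zero_left]; exact zero_le_one
  refine le_of_forall_pos_le_add fun ε hε => hx v hv0 (1 + ε) ?_
  have : lpBall n p ∩ {y | 1 + ε ≤ ⟪v, y⟫} = ∅ := by
    rw [eq_empty_iff_forall_notMem]
    rintro y ⟨hy1, hy2⟩
    have hy2 : 1 + ε ≤ ⟪v, y⟫ := hy2
    linarith [inner_le_one_of_mem_lpBall hpq.symm hv hy1]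
  rw [this, measure_empty]
  exact zero_le

lemma subset_illuminationBody {Q : Set (Euc n)} (hQ : Convex ℝ Q) {δ : ℝ} (hδ : 0 ≤ δ) :
    Q ⊆ illuminationBody Q δ := by
  intro y hy
  refine mem_illuminationBody_of_volume_sdiff_le hδ ?_
  rw [union_eq_self_of_subset_right (singleton_subset_iff.2 hy), hQ.convexHull_eq, sdiff_self]
  simp

lemma polarBody_illuminationBody_subset (hpq : p.HolderConjugate q) {δ : ℝ} (hδ : 0 ≤ δ) :
    polarBody (illuminationBody (lpBall n q) δ) ⊆ lpBall n p := by
  intro x hx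
  rw [← polarBody_lpBall n hpq.symm]
  exact fun v hv => hx v (subset_illuminationBody (convex_lpBall n hpq.symm.lt.le) hδ hv)

lemma smul_mem_lpBall (hp : 1 ≤ p) {x : Euc n} (hx : x ∈ lpBall n p) {c : ℝ} (h0 : 0 ≤ c)
    (h1 : c ≤ 1) : c • x ∈ lpBall n p :=
  (convex_lpBall n hp).smul_mem_of_zero_mem (zero_mem_lpBall n (by linarith)) hx ⟨h0, h1⟩

lemma bddBelow_bodyDist (C₁ C₂ : Set (Euc n)) :
    BddBelow {a : ℝ | 1 ≤ a ∧ a⁻¹ • C₁ ⊆ C₂ ∧ C₂ ⊆ a • C₁} := ⟨1, fun _ ha => ha.1⟩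

lemma dualDist_le_of_smul_mem (hpq : p.HolderConjugate q) {δ c : ℝ} (hc0 : 0 < c) (hc1 : c < 1)
    (H : ∀ y ∈ lpBall n p, c • y ∈ floatingBody (lpBall n p) δ) :
    dualDist (lpBall n p) δ ≤ c⁻¹ := by
  have hc : 1 < c⁻¹ := (one_lt_inv₀ hc0).2 hc1
  obtain ⟨δ', hδ', H'⟩ := exists_illuminationBody_inner_le (n := n) hpq (sub_pos.2 hc)
  have hbdd : BddBelow {r : ℝ | ∃ δ' > (0 : ℝ), r = bodyDist (floatingBody (lpBall n p) δ)
      (polarBody (illuminationBody (polarBody (lpBall n p)) δ'))} := by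
    refine ⟨0, ?_⟩
    rintro _ ⟨_, -, rfl⟩
    exact Real.sInf_nonneg fun a ha => zero_le_one.trans ha.1
  refine (csInf_le hbdd ⟨δ', hδ', rfl⟩).trans (csInf_le (bddBelow_bodyDist _ _) ⟨hc.le, ?_, ?_⟩)
  · rw [polarBody_lpBall n hpq, inv_inv]
    rintro _ ⟨x, hx, rfl⟩ y hy
    change ⟪y, c • x⟫ ≤ 1
    have := H' y hy x (floatingBody_lpBall_subset hpq δ hx)
    rw [real_inner_smul_right, real_inner_comm]
    calc c * ⟪x, y⟫ ≤ c * (1 + (c⁻¹ - 1)) := by gcongr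
      _ = 1 := by field_simp; ring
  · rw [polarBody_lpBall n hpq]
    intro x hx
    rw [mem_smul_set_iff_inv_smul_mem₀ (by positivity), inv_inv]
    exact H x (polarBody_illuminationBody_subset hpq hδ'.le hx)

lemma bodyDist_nonempty (hpq : p.HolderConjugate q) {δ c : ℝ} (hc0 : 0 < c)
    (H : ∀ y ∈ lpBall n p, c • y ∈ floatingBody (lpBall n p) δ) {δ' : ℝ} (hδ' : 0 < δ') :
    {a : ℝ | 1 ≤ a ∧ a⁻¹ • floatingBody (lpBall n p) δ
        ⊆ polarBody (illuminationBody (polarBody (lpBall n p)) δ') ∧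
      polarBody (illuminationBody (polarBody (lpBall n p)) δ')
        ⊆ a • floatingBody (lpBall n p) δ}.Nonempty := by
  rw [polarBody_lpBall n hpq]
  have hq := hpq.symm.lt
  set R : ℝ := 2 ^ (n + 1) * (1 + δ') with hR
  set a := max 1 (max R c⁻¹) with ha
  have ha1 : 1 ≤ a := le_max_left _ _
  have haR : R ≤ a := (le_max_left _ _).trans (le_max_right _ _)
  have hac : c⁻¹ ≤ a := (le_max_right _ _).trans (le_max_right _ _)
  have ha0 : 0 < a := by linarith
  refine ⟨a, ha1, ?_, ?_⟩
  · rintro _ ⟨x, hx, rfl⟩ y hy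
    change ⟪y, a⁻¹ • x⟫ ≤ 1
    have hxB := floatingBody_lpBall_subset hpq δ hx
    have := inner_le_of_mem_illuminationBody (volume_lpBall_lt_top n (by linarith)).ne
      (volume_lpBall_pos n (by linarith)).ne' (zero_mem_lpBall n (by linarith))
      (fun z hz => neg_mem_lpBall hz) hδ'.le hy
      (fun z hz => inner_le_one_of_mem_lpBall hpq hxB hz)
    rw [real_inner_smul_right, real_inner_comm, inv_mul_le_iff₀ ha0, mul_one]
    exact this.trans haR
  · intro x hx
    rw [mem_smul_set_iff_inv_smul_mem₀ ha0.ne']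
    have h1 : (c * a)⁻¹ • x ∈ lpBall n p := by
      refine smul_mem_lpBall hpq.lt.le (polarBody_illuminationBody_subset hpq hδ'.le hx)
        (by positivity) (inv_le_one_of_one_le₀ ?_)
      rwa [inv_le_iff_one_le_mul₀' hc0] at hac
    have h2 := H _ h1
    rwa [smul_smul, mul_inv, mul_inv_cancel_left₀ hc0.ne'] at h2

lemma eventually_le_dualDist {m : ℕ} (hm : m ≠ 0) (hp : 2 < p) {T₁ T₂ ε : ℝ}
    (hε : 0 < ε) (hεT : ε ≤ T₁) (hT₂ : 0 < T₂)
    (h1 : capConst m * T₁ ^ ((m : ℝ) / 2 + 1) <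
      (volume (lpBall (m + 1) p)).toReal * √(diagWeight (m + 1) p ^ (m + 1) / (p - 1)))
    (h2 : (volume (lpBall (m + 1) p)).toReal * √(diagWeight (m + 1) p ^ (m + 1) / (p - 1))
      < capConst m * T₂ ^ ((m : ℝ) / 2 + 1)) :
    ∀ᶠ δ : ℝ in 𝓝[>] 0, 1 + (T₁ - ε) * δ ^ ((2 : ℝ) / (((m + 1 : ℕ) : ℝ) + 1))
      ≤ dualDist (lpBall (m + 1) p) δ := by
  have hT₁ : 0 < T₁ := by linarith
  set q := p.conjExponent with hq
  have hpq : p.HolderConjugate q := Real.HolderConjugate.conjExponent (by linarith)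
  have hq2 : q < 2 := by
    rw [hq, Real.conjExponent, div_lt_iff₀ (by linarith)]; linarith
  set w := diagPoint (m + 1) p with hw
  have hwS : ∑ i, |w i| ^ p = 1 := sum_abs_diagPoint (Nat.succ_pos m) (by linarith)
  have hw0 : ∀ i, 0 < w i := fun i => by rw [hw, diagPoint_apply]; positivity
  set v := dualityMap p w with hv
  have hvS : ∑ i, |v i| ^ q = 1 := by rw [hv, sum_abs_dualityMap hpq, hwS]
  have hv0 : ∀ i, v i ≠ 0 := fun i => by
    have := hw0 i
    rw [hv, dualityMap_apply, abs_of_pos this]; positivity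
  have hvw : dualityMap q v = w := dualityMap_dualityMap hpq.symm w
  obtain ⟨σ₀, hσ₀, H⟩ := exists_smul_single_mem_illuminationBody hm hpq hq2 hvS hv0
    (show 0 < (2 * T₁ + 2 * T₂) / ε by positivity)
  have hα : Tendsto (fun δ : ℝ => δ ^ ((2 : ℝ) / (((m + 1 : ℕ) : ℝ) + 1))) (𝓝[>] 0) (𝓝 0) :=
    tendsto_rpow_nhdsGT_zero (by positivity)
  filter_upwards [eventually_smul_mem_floatingBody hp hT₂ h2,
    eventually_floatingBody_inner_le hp hT₁ h1,
    hα.eventually (Iic_mem_nhds (show 0 < σ₀ / ε by positivity)),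
    hα.eventually (Iic_mem_nhds (show 0 < 1 / (2 * T₂) by positivity)),
    hα.eventually (Iic_mem_nhds (show 0 < 1 / (2 * T₁) by positivity)),
    self_mem_nhdsWithin] with δ hin hout hα1 hα2 hα3 hδ
  have hδ : 0 < δ := hδ
  set α := δ ^ ((2 : ℝ) / (((m + 1 : ℕ) : ℝ) + 1)) with hαd
  have hα0 : 0 < α := by positivity
  have hα1 : α ≤ σ₀ / ε := hα1
  have hα2 : α ≤ 1 / (2 * T₂) := hα2
  have hα3 : α ≤ 1 / (2 * T₁) := hα3
  rw [le_div_iff₀ (by positivity)] at hα1 hα2 hα3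
  have hc0 : 0 < 1 - T₂ * α := by linarith
  refine le_csInf ⟨_, 1, one_pos, rfl⟩ ?_
  rintro _ ⟨δ', hδ', rfl⟩
  refine le_csInf (bodyDist_nonempty hpq hc0 hin hδ') ?_
  rintro a ⟨ha1, ha2, ha3⟩
  rw [polarBody_lpBall _ hpq] at ha2 ha3
  have ha0 : 0 < a := by linarith
  by_cases hP : (1 - ε * α) • w ∈ polarBody (illuminationBody (lpBall (m + 1) q) δ')
  · have h3 := ha3 hP
    rw [mem_smul_set_iff_inv_smul_mem₀ ha0.ne'] at h3
    have h4 := hout _ h3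
    rw [real_inner_smul_right, real_inner_smul_right, inner_dualityMap_self (by linarith), hwS,
      mul_one, inv_mul_le_iff₀ ha0] at h4
    by_contra! hlt
    have h5 : a * (1 - T₁ * α) < (1 + (T₁ - ε) * α) * (1 - T₁ * α) := by
      gcongr; linarith
    have h6 : 0 ≤ (T₁ - ε) * α * (T₁ * α) :=
      mul_nonneg (mul_nonneg (by linarith) hα0.le) (by positivity)
    nlinarith
  · simp only [polarBody, mem_ofPred_eq, not_forall, not_le] at hP
    obtain ⟨y, hy, hyw⟩ := hP
    rw [real_inner_smul_right] at hyw
    have hεα : ε * α ≤ 1 / 2 := by nlinarith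
    have h3 : 1 + ε * α ≤ ⟪dualityMap q v, y⟫ := by
      rw [hvw, real_inner_comm]
      by_contra! hlt
      have h4 : (1 - ε * α) * ⟪y, w⟫ ≤ (1 - ε * α) * (1 + ε * α) :=
        mul_le_mul_of_nonneg_left hlt.le (by linarith)
      nlinarith [sq_nonneg (ε * α)]
    have h4 := H (ε * α) (by positivity) (by linarith) δ' hδ'.le y hy h3
    have he : (EuclideanSpace.single 0 1 : Euc (m + 1)) ∈ lpBall (m + 1) p := by
      change ∑ i, |(EuclideanSpace.single 0 1 : Euc (m + 1)) i| ^ p ≤ 1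
      rw [Fin.sum_univ_succ]
      simp [Fin.succ_ne_zero, Real.zero_rpow (by linarith : p ≠ 0)]
    have h5 := ha2 (smul_mem_smul_set (hin _ he)) _ h4
    rw [real_inner_smul_left, real_inner_smul_right, real_inner_smul_right,
      real_inner_self_eq_norm_sq] at h5
    simp only [PiLp.norm_single, norm_one, one_pow, mul_one] at h5
    have h6 : (1 + (2 * T₁ + 2 * T₂) / ε * (ε * α)) * (1 - T₂ * α) ≤ a := by
      calc _ = a * ((1 + (2 * T₁ + 2 * T₂) / ε * (ε * α)) * (a⁻¹ * (1 - T₂ * α))) := by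
            field_simp
        _ ≤ a * 1 := by gcongr
        _ = a := mul_one a
    have h7 : (2 * T₁ + 2 * T₂) / ε * (ε * α) = (2 * T₁ + 2 * T₂) * α := by field_simp
    rw [h7] at h6
    have h8 : T₂ * α ≤ 1 / 2 := by linarith
    have h9 : (2 * T₁ + 2 * T₂) * α * (T₂ * α) ≤ (2 * T₁ + 2 * T₂) * α * (1 / 2) := by gcongr
    have h10 : 0 ≤ ε * α := by positivity
    nlinarith

/-- The asymptotics of the dual distance of `ℓ_p` balls for `p > 2`. -/
theorem tendsto_dualDist_lpBall {m : ℕ} (hm : m ≠ 0) (hp : 2 < p) {T : ℝ} (hT0 : 0 < T)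
    (hT : capConst m * T ^ ((m : ℝ) / 2 + 1) =
      (volume (lpBall (m + 1) p)).toReal * √(diagWeight (m + 1) p ^ (m + 1) / (p - 1))) :
    Tendsto (fun δ : ℝ => (dualDist (lpBall (m + 1) p) δ - 1)
      / δ ^ ((2 : ℝ) / (((m + 1 : ℕ) : ℝ) + 1))) (𝓝[>] 0) (𝓝 T) := by
  have hc := capConst_pos m
  have hlt : ∀ {a b : ℝ}, 0 ≤ a → a < b →
      capConst m * a ^ ((m : ℝ) / 2 + 1) < capConst m * b ^ ((m : ℝ) / 2 + 1) := fun h0 h =>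
    mul_lt_mul_of_pos_left (Real.rpow_lt_rpow h0 h (by positivity)) hc
  have hα : Tendsto (fun δ : ℝ => δ ^ ((2 : ℝ) / (((m + 1 : ℕ) : ℝ) + 1))) (𝓝[>] 0) (𝓝 0) :=
    tendsto_rpow_nhdsGT_zero (by positivity)
  refine tendsto_order.2 ⟨fun b hb => ?_, fun b hb => ?_⟩
  · have hb0 : 0 ≤ max b 0 := le_max_right _ _
    have hbb : b ≤ max b 0 := le_max_left _ _
    have hbT : max b 0 < T := max_lt hb hT0
    set b' := max b 0
    set T₁ := (b' + T) / 2 with hT₁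
    filter_upwards [eventually_le_dualDist hm hp (T₁ := T₁) (T₂ := T + 1) (ε := (T₁ - b') / 2)
      (by linarith) (by linarith) (by linarith) (by rw [← hT]; exact hlt (by linarith) (by linarith))
      (by rw [← hT]; exact hlt (by linarith) (by linarith)), self_mem_nhdsWithin] with δ h1 hδ
    have hδ : 0 < δ := hδ
    rw [lt_div_iff₀ (by positivity)]
    have h2 : b * δ ^ ((2 : ℝ) / (((m + 1 : ℕ) : ℝ) + 1))
        < (T₁ - (T₁ - b') / 2) * δ ^ ((2 : ℝ) / (((m + 1 : ℕ) : ℝ) + 1)) := by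
      gcongr; linarith
    linarith
  · set T' := (b + T) / 2 with hT'
    have hpq : p.HolderConjugate p.conjExponent := Real.HolderConjugate.conjExponent (by linarith)
    have hlim : Tendsto (fun δ : ℝ => T' / (1 - T' * δ ^ ((2 : ℝ) / (((m + 1 : ℕ) : ℝ) + 1))))
        (𝓝[>] 0) (𝓝 T') := by
      simpa [Pi.div_def] using
        (tendsto_const_nhds (x := T')).div ((hα.const_mul T').const_sub 1) (by simp)
    filter_upwards [eventually_smul_mem_floatingBody hp (T := T') (by linarith)
      (by rw [← hT]; exact hlt hT0.le (by linarith)),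
      hα.eventually (gt_mem_nhds (show 0 < 1 / T' from one_div_pos.2 (by linarith))),
      hlim.eventually (gt_mem_nhds (show T' < b by linarith)), self_mem_nhdsWithin] with δ h1 h2 h3 hδ
    have hδ : 0 < δ := hδ
    have hT0' : 0 < T' := by linarith
    set α := δ ^ ((2 : ℝ) / (((m + 1 : ℕ) : ℝ) + 1)) with hαd
    have hα0 : 0 < α := by positivity
    rw [lt_div_iff₀ hT0'] at h2
    have hc0 : 0 < 1 - T' * α := by linarith
    have h4 := dualDist_le_of_smul_mem hpq hc0 (by nlinarith) h1
    refine lt_of_le_of_lt ?_ h3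
    rw [div_le_iff₀ hα0]
    calc _ ≤ (1 - T' * α)⁻¹ - 1 := by linarith
      _ = _ := by field_simp; ring

end Distance

section Curvature

/-- The outer unit normals of the `ℓ_p` ball are given by the duality map. -/
lemma IsOuterNormalAt.eq_smul_dualityMap {n : ℕ} {p : ℝ} (hp : 1 < p) {x ν : Euc n}
    (hx : ∑ i, |x i| ^ p = 1) (h : IsOuterNormalAt (lpBall n p) x ν) :
    0 < ⟪x, ν⟫ ∧ ν = ⟪x, ν⟫ • dualityMap p x := by
  obtain ⟨hν, hmax⟩ := h
  have hp0 : p ≠ 0 := by linarith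
  have hx' : x ∈ lpBall n p := hx.le
  set c := ⟪x, ν⟫ with hc
  have hc0 : 0 ≤ c := by
    have := hmax (-x) (neg_mem_lpBall hx')
    rw [inner_neg_left] at this
    linarith
  have hle : ∀ y : Euc n, ⟪y, ν⟫ ≤ c * (∑ i, |y i| ^ p) ^ (1 / p) := by
    intro y
    rcases eq_or_ne y 0 with rfl | hy
    · rw [inner_zero_left]
      exact mul_nonneg hc0 (Real.rpow_nonneg (Finset.sum_nonneg fun i _ => by positivity) _)
    · have hS := sum_abs_pos (p := p) hy
      set r := (∑ i, |y i| ^ p) ^ (1 / p) with hr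
      have hr0 : 0 < r := by positivity
      have hmem : y ∈ r • lpBall n p := by
        rw [mem_smul_lpBall_iff hr0, hr, ← Real.rpow_mul hS.le, one_div_mul_cancel hp0,
          Real.rpow_one]
      obtain ⟨w, hw, hwy⟩ := hmem
      have hyr : ⟪y, ν⟫ = r * ⟪w, ν⟫ := (congrArg (⟪·, ν⟫) hwy).symm.trans
        (real_inner_smul_left w ν r)
      rw [hyr, mul_comm]
      exact mul_le_mul_of_nonneg_right (hmax w hw) hr0.le
  have hν' : ν = c • dualityMap p x := by
    refine ext_inner_left ℝ fun z => ?_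
    have hd : ∀ i, HasDerivAt (fun t : ℝ => |x i + t * z i| ^ p) (p * (dualityMap p x i * z i)) 0 := by
      intro i
      have h1 : HasDerivAt (fun t : ℝ => x i + t * z i) (z i) 0 := by
        simpa using ((hasDerivAt_id (0 : ℝ)).mul_const (z i)).const_add (x i)
      have h2 : HasDerivAt (fun s : ℝ => |s| ^ p) (p * |x i| ^ (p - 2) * x i) (x i + 0 * z i) := by
        simpa using hasDerivAt_abs_rpow (x i) hp
      have h3 := h2.comp (0 : ℝ) h1
      rwa [show p * |x i| ^ (p - 2) * x i * z i = p * (dualityMap p x i * z i) by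
        rw [dualityMap_apply]; ring] at h3
    have hsum : HasDerivAt (fun t : ℝ => ∑ i, |x i + t * z i| ^ p) (p * ⟪dualityMap p x, z⟫) 0 := by
      rw [euc_inner_eq, Finset.mul_sum]
      exact HasDerivAt.fun_sum fun i _ => hd i
    have hval : ∑ i, |x i + 0 * z i| ^ p = 1 := by simpa using hx
    have hpow := (hsum.rpow_const (p := 1 / p) (Or.inl (by rw [hval]; exact one_ne_zero))).const_mul c
    rw [hval, Real.one_rpow] at hpow
    have hlin : HasDerivAt (fun t : ℝ => ⟪x, ν⟫ + t * ⟪z, ν⟫) ⟪z, ν⟫ 0 := by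
      simpa using ((hasDerivAt_id (0 : ℝ)).mul_const ⟪z, ν⟫).const_add ⟪x, ν⟫
    have hmin : IsLocalMin (fun t : ℝ => c * (∑ i, |x i + t * z i| ^ p) ^ (1 / p)
        - (⟪x, ν⟫ + t * ⟪z, ν⟫)) 0 := by
      refine Eventually.of_forall fun t => ?_
      simp only [hx, Real.one_rpow, zero_mul, add_zero, mul_one]
      rw [← hc, sub_self, sub_nonneg, hc, ← real_inner_smul_left, ← inner_add_left]
      exact hle (x + t • z)
    have := hmin.hasDerivAt_eq_zero (hpow.sub hlin)
    rw [real_inner_smul_right, real_inner_comm (dualityMap p x)]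
    have h3 : c * (p * ⟪dualityMap p x, z⟫ * (1 / p) * 1) = c * ⟪dualityMap p x, z⟫ := by
      field_simp
    linarith
  refine ⟨lt_of_le_of_ne hc0 fun h0 => ?_, hν'⟩
  rw [← h0, zero_smul] at hν'
  rw [hν', norm_zero] at hν
  exact zero_ne_one hν

/-- A second order Taylor expansion of `|x + s(t)| ^ p` along a curve with `s(t) ∼ c t`. -/
lemma tendsto_abs_rpow_taylor {p : ℝ} (hp : 2 < p) {x c : ℝ} (hx : |x| ≤ 1) {s : ℝ → ℝ}
    (hs : Tendsto (fun t => s t / t) (𝓝[≠] 0) (𝓝 c)) :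
    Tendsto (fun t => (|x + s t| ^ p - |x| ^ p - p * (|x| ^ (p - 2) * x) * s t) / t ^ 2) (𝓝[≠] 0)
      (𝓝 (p * ((p - 1) * |x| ^ (p - 2)) / 2 * c ^ 2)) := by
  set A := p * ((p - 1) * |x| ^ (p - 2)) / 2 with hA
  set R : ℝ → ℝ := fun t => |x + s t| ^ p - |x| ^ p - p * (|x| ^ (p - 2) * x) * s t - A * s t ^ 2
    with hR
  have hid : Tendsto (fun t : ℝ => t) (𝓝[≠] 0) (𝓝 0) := tendsto_id.mono_left nhdsWithin_le_nhds
  have hs0 : Tendsto s (𝓝[≠] 0) (𝓝 0) := by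
    have h1 := hs.mul hid
    rw [mul_zero] at h1
    refine h1.congr' ?_
    filter_upwards [self_mem_nhdsWithin] with t ht
    have ht : t ≠ 0 := ht
    field_simp
  have hs2 : Tendsto (fun t => s t ^ 2 / t ^ 2) (𝓝[≠] 0) (𝓝 (c ^ 2)) := by
    simpa only [div_pow] using hs.pow 2
  have hRo : R =o[𝓝[≠] 0] fun t => s t ^ 2 := by
    refine Asymptotics.isLittleO_iff.2 fun ω hω => ?_
    obtain ⟨r, hr, H⟩ := abs_rpow_taylor hp hω
    have h1 : ∀ᶠ t in 𝓝[≠] 0, |s t| ≤ r := by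
      have := hs0.abs
      rw [abs_zero] at this
      exact this.eventually (Iic_mem_nhds hr)
    filter_upwards [h1] with t ht
    rw [Real.norm_eq_abs, Real.norm_eq_abs, abs_of_nonneg (sq_nonneg (s t))]
    exact H x hx (s t) ht
  have hsO : (fun t => s t ^ 2) =O[𝓝[≠] 0] fun t => t ^ 2 := by
    refine Asymptotics.isBigO_of_div_tendsto_nhds ?_ _ hs2
    filter_upwards [self_mem_nhdsWithin] with t ht h0
    exact absurd (pow_eq_zero_iff two_ne_zero |>.1 h0) ht
  have hR0 := (hRo.trans_isBigO hsO).tendsto_div_nhds_zero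
  have := hR0.add (hs2.const_mul A)
  rw [zero_add] at this
  refine this.congr fun t => ?_
  simp only [hR]
  ring

lemma tendsto_div_sq_of_contDiffAt {m : ℕ} {f : Euc m → ℝ} (hf : ContDiffAt ℝ 2 f 0)
    (h0 : f 0 = 0) (hf0 : fderiv ℝ f 0 = 0) (e : Euc m) :
    Tendsto (fun t : ℝ => f (t • e) / t ^ 2) (𝓝[≠] 0) (𝓝 (fderiv ℝ (fderiv ℝ f) 0 e e / 2)) := by
  have hline : ∀ t : ℝ, HasDerivAt (fun t : ℝ => t • e) e t := fun t => by
    simpa using (hasDerivAt_id t).smul_const e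
  have hev : ∀ᶠ v in 𝓝 (0 : Euc m), ContDiffAt ℝ 2 f v := hf.eventually (by simp)
  have hlim : Tendsto (fun t : ℝ => t • e) (𝓝 0) (𝓝 0) := by
    simpa using (hline 0).continuousAt.tendsto
  have hψ : ∀ᶠ t in 𝓝[≠] (0 : ℝ), HasDerivAt (fun t : ℝ => f (t • e)) (fderiv ℝ f (t • e) e) t := by
    filter_upwards [(hlim.eventually hev).filter_mono nhdsWithin_le_nhds] with t ht
    exact (ht.differentiableAt (by norm_num)).hasFDerivAt.comp_hasDerivAt t (hline t)
  have hD : DifferentiableAt ℝ (fderiv ℝ f) 0 :=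
    (hf.fderiv_right (m := 1) (by norm_num)).differentiableAt (by norm_num)
  have hD1 : HasDerivAt (fun t : ℝ => fderiv ℝ f (t • e) e) (fderiv ℝ (fderiv ℝ f) 0 e e) 0 := by
    have h1 : HasFDerivAt (fderiv ℝ f) (fderiv ℝ (fderiv ℝ f) 0) ((0 : ℝ) • e) := by
      rw [zero_smul]; exact hD.hasFDerivAt
    have h2 : HasDerivAt (fun t : ℝ => fderiv ℝ f (t • e)) (fderiv ℝ (fderiv ℝ f) 0 e) 0 :=
      h1.comp_hasDerivAt (0 : ℝ) (hline 0)
    exact ((ContinuousLinearMap.apply ℝ ℝ e).hasFDerivAt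
      (x := fderiv ℝ f ((0 : ℝ) • e))).comp_hasDerivAt (0 : ℝ) h2
  have hslope := hasDerivAt_iff_tendsto_slope_zero.1 hD1
  simp only [zero_add, zero_smul, hf0, zero_apply, sub_zero,
    smul_eq_mul] at hslope
  refine HasDerivAt.lhopital_zero_nhdsNE (g' := fun t => 2 * t) hψ
    (Eventually.of_forall fun t => by simpa using hasDerivAt_pow 2 t) ?_ ?_ ?_ ?_
  · filter_upwards [self_mem_nhdsWithin] with t ht
    exact mul_ne_zero two_ne_zero ht
  · have := (hf.continuousAt.tendsto.comp hlim).mono_left (nhdsWithin_le_nhds (s := {0}ᶜ))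
    rwa [h0] at this
  · have := (continuous_pow 2).tendsto (0 : ℝ)
    rw [zero_pow two_ne_zero] at this
    exact this.mono_left nhdsWithin_le_nhds
  · refine (hslope.div_const 2).congr fun t => ?_
    rw [inv_mul_eq_div, div_div, mul_comm t]

lemma det_transpose_mul_diagonal_mul {m : ℕ} (L : Euc m →ₗᵢ[ℝ] Euc (m + 1)) {ν : Euc (m + 1)}
    (hν : ‖ν‖ = 1) (hL : ∀ v, ⟪L v, ν⟫ = 0) (a : Fin (m + 1) → ℝ) :
    (Matrix.of fun i j : Fin m => ∑ k, a k * (L (EuclideanSpace.single i 1) k *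
      L (EuclideanSpace.single j 1) k)).det = ∑ i, ν i ^ 2 * ∏ j ∈ Finset.univ.erase i, a j := by
  set c : Fin (m + 1) → Euc (m + 1) := Fin.cons ν (fun j => L (EuclideanSpace.single j 1)) with hc
  set O : Matrix (Fin (m + 1)) (Fin (m + 1)) ℝ := Matrix.of fun i j => c j i with hO
  have hOO : O.transpose * O = 1 := by
    ext i j
    have h1 : (O.transpose * O) i j = ⟪c i, c j⟫ := by
      rw [euc_inner_eq]; rfl
    rw [h1]
    refine Fin.cases ?_ (fun i => ?_) i <;> refine Fin.cases ?_ (fun j => ?_) j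
    · simp [hc, hν]
    · rw [hc, Fin.cons_zero, Fin.cons_succ, real_inner_comm, hL, Matrix.one_apply,
        if_neg (Fin.succ_ne_zero j).symm]
    · simp [hc, hL, Fin.succ_ne_zero i]
    · simp only [hc, Fin.cons_succ, LinearIsometry.inner_map_map, Matrix.one_apply, Fin.succ_inj]
      rw [EuclideanSpace.inner_single_left]
      simp
  have hdet : O.det ^ 2 = 1 := by
    have := congrArg Matrix.det hOO
    rwa [Matrix.det_mul, Matrix.det_transpose, Matrix.det_one, ← sq] at this
  have hOO' : O * O.transpose = 1 := mul_eq_one_comm.1 hOO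
  have hadj : O.adjugate = O.det • O.transpose := by
    calc O.adjugate = O.adjugate * (O * O.transpose) := by rw [hOO', mul_one]
      _ = _ := by rw [← mul_assoc, Matrix.adjugate_mul, smul_mul_assoc, one_mul]
  have hM : (O.transpose * Matrix.diagonal a * O).adjugate
      = O.transpose * (Matrix.diagonal a).adjugate * O := by
    rw [Matrix.adjugate_mul_distrib, Matrix.adjugate_mul_distrib, ← Matrix.adjugate_transpose, hadj,
      Matrix.transpose_smul, Matrix.transpose_transpose, smul_mul_assoc, mul_smul_comm,
      mul_smul_comm, smul_smul, ← sq, hdet, one_smul, mul_assoc]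
  have hentry : ∀ (d : Fin (m + 1) → ℝ) i j, (O.transpose * Matrix.diagonal d * O) i j
      = ∑ k, d k * (c i k * c j k) := by
    intro d i j
    rw [Matrix.mul_apply]
    refine Finset.sum_congr rfl fun k _ => ?_
    rw [Matrix.mul_diagonal, Matrix.transpose_apply]
    simp only [hO, Matrix.of_apply]
    ring
  have h00 := congrFun (congrFun hM 0) 0
  rw [Matrix.adjugate_fin_succ_eq_det_submatrix, Matrix.adjugate_diagonal, hentry] at h00
  simp only [Fin.val_zero, add_zero, pow_zero, one_mul, Fin.succAbove_zero] at h00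
  have e1 : (O.transpose * Matrix.diagonal a * O).submatrix Fin.succ Fin.succ
      = Matrix.of fun i j : Fin m => ∑ k, a k * (L (EuclideanSpace.single i 1) k *
      L (EuclideanSpace.single j 1) k) := by
    ext i j
    rw [Matrix.submatrix_apply, hentry]
    rfl
  rw [e1] at h00
  rw [h00]
  refine Finset.sum_congr rfl fun k _ => ?_
  simp only [hc, Fin.cons_zero]
  ring

end Curvature

section Hessian

/-- The Hessian of a graph representation of the boundary of the `ℓ_p` ball. -/
lemma fderiv_fderiv_graph_lpBall {m : ℕ} {p : ℝ} (hp : 2 < p) {x ν : Euc (m + 1)}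
    (hx : ∑ i, |x i| ^ p = 1) (hν : IsOuterNormalAt (lpBall (m + 1) p) x ν)
    {L : Euc m →ₗᵢ[ℝ] Euc (m + 1)} {f : Euc m → ℝ} {τ ε : ℝ} (hτ : 0 < τ) (hε : 0 < ε)
    (hL : ∀ v, ⟪L v, ν⟫ = 0) (hf : ContDiffAt ℝ 2 f 0) (h0 : f 0 = 0) (hf0 : fderiv ℝ f 0 = 0)
    (hgraph : {y | ∃ v ∈ ball (0 : Euc m) τ, y = x + L v - f v • ν} ∩ ball x ε ⊆
      frontier (lpBall (m + 1) p)) (e : Euc m) :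
    fderiv ℝ (fderiv ℝ f) 0 e e = ∑ i, ⟪x, ν⟫ * ((p - 1) * |x i| ^ (p - 2)) * (L e i * L e i) := by
  have hp1 : 1 < p := by linarith
  obtain ⟨hpos, hνeq⟩ := hν.eq_smul_dualityMap hp1 hx
  set h := ⟪x, ν⟫ with hh
  have hg : dualityMap p x = h⁻¹ • ν := by
    rw [hνeq, smul_smul, inv_mul_cancel₀ hpos.ne', one_smul]
  have hT := tendsto_div_sq_of_contDiffAt hf h0 hf0 e
  have hid : Tendsto (fun t : ℝ => t) (𝓝[≠] 0) (𝓝 0) := tendsto_id.mono_left nhdsWithin_le_nhds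
  have hT1 : Tendsto (fun t : ℝ => f (t • e) / t) (𝓝[≠] 0) (𝓝 0) := by
    have h1 := hT.mul hid
    rw [mul_zero] at h1
    refine h1.congr' ?_
    filter_upwards [self_mem_nhdsWithin] with t ht
    have ht : t ≠ 0 := ht
    field_simp
  set s : Fin (m + 1) → ℝ → ℝ := fun i t => t * L e i - f (t • e) * ν i with hs
  have hsi : ∀ i, Tendsto (fun t => s i t / t) (𝓝[≠] 0) (𝓝 (L e i)) := by
    intro i
    have h1 := (hT1.mul_const (ν i)).const_sub (L e i)
    rw [zero_mul, sub_zero] at h1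
    refine h1.congr' ?_
    filter_upwards [self_mem_nhdsWithin] with t ht
    have ht : t ≠ 0 := ht
    simp only [hs]
    field_simp
  have hsum := tendsto_finsetSum Finset.univ fun i (_ : i ∈ Finset.univ) =>
    tendsto_abs_rpow_taylor hp (abs_le_one_of_mem_lpBall (by linarith) hx.le i) (hsi i)
  have hline : Tendsto (fun t : ℝ => t • e) (𝓝 0) (𝓝 0) := by
    have : Continuous fun t : ℝ => t • e := by fun_prop
    simpa using this.tendsto 0
  have hcurve : Tendsto (fun t : ℝ => x + L (t • e) - f (t • e) • ν) (𝓝 0) (𝓝 x) := by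
    have h1 := ((L.continuous.tendsto 0).comp hline).const_add x
    have h2 := ((hf.continuousAt.tendsto.comp hline).smul_const ν)
    have h3 := h1.sub h2
    rw [h0, zero_smul, map_zero, add_zero, sub_zero] at h3
    exact h3
  have hmem : ∀ᶠ t in 𝓝[≠] (0 : ℝ), ∑ i, |x i + s i t| ^ p = 1 := by
    have h1 := hline.eventually (ball_mem_nhds 0 hτ)
    have h2 := hcurve.eventually (ball_mem_nhds x hε)
    filter_upwards [h1.filter_mono nhdsWithin_le_nhds, h2.filter_mono nhdsWithin_le_nhds]
      with t ht1 ht2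
    have h3 := hgraph ⟨⟨t • e, ht1, rfl⟩, ht2⟩
    rw [frontier_lpBall _ (by linarith), mem_ofPred_eq] at h3
    rw [← h3]
    refine Finset.sum_congr rfl fun i _ => ?_
    simp only [hs, PiLp.sub_apply, PiLp.add_apply, PiLp.smul_apply, map_smul, smul_eq_mul,
      add_sub_assoc]
  have hinner : ∀ t, ∑ i, |x i| ^ (p - 2) * x i * s i t = - (h⁻¹ * f (t • e)) := by
    intro t
    have h1 : ∑ i, |x i| ^ (p - 2) * x i * s i t
        = ⟪dualityMap p x, t • L e - f (t • e) • ν⟫ := by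
      rw [euc_inner_eq]; rfl
    rw [h1, hg, inner_sub_right, real_inner_smul_left, real_inner_smul_left, real_inner_smul_right,
      real_inner_smul_right, real_inner_comm, hL, real_inner_self_eq_norm_sq, hν.1]
    ring
  have hlim : Tendsto (fun t : ℝ => p * h⁻¹ * (f (t • e) / t ^ 2)) (𝓝[≠] 0)
      (𝓝 (∑ i, p * ((p - 1) * |x i| ^ (p - 2)) / 2 * L e i ^ 2)) := by
    refine hsum.congr' ?_
    filter_upwards [hmem] with t ht
    rw [← Finset.sum_div, Finset.sum_sub_distrib, Finset.sum_sub_distrib, ht, hx]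
    have h1 : ∑ i, p * (|x i| ^ (p - 2) * x i) * s i t = p * -(h⁻¹ * f (t • e)) := by
      rw [← hinner, Finset.mul_sum]
      exact Finset.sum_congr rfl fun i _ => by ring
    rw [h1]
    ring
  have huniq := tendsto_nhds_unique (hT.const_mul (p * h⁻¹)) hlim
  have hp0 : p ≠ 0 := by linarith
  have h1 : ∑ i, p * ((p - 1) * |x i| ^ (p - 2)) / 2 * L e i ^ 2
      = p / 2 * ∑ i, (p - 1) * |x i| ^ (p - 2) * (L e i * L e i) := by
    rw [Finset.mul_sum]
    exact Finset.sum_congr rfl fun i _ => by ring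
  rw [h1] at huniq
  simp only [mul_assoc h]
  rw [← Finset.mul_sum]
  field_simp at huniq
  rw [huniq]
  simp only [sq]

/-- The Gauss curvature of the `ℓ_p` ball. -/
lemma IsGaussCurvatureAt.lpBall_eq {m : ℕ} {p : ℝ} (hp : 2 < p) {x ν : Euc (m + 1)} {k : ℝ}
    (hx : ∑ i, |x i| ^ p = 1) (hν : IsOuterNormalAt (lpBall (m + 1) p) x ν)
    (hk : IsGaussCurvatureAt (lpBall (m + 1) p) x ν k) :
    k = ⟪x, ν⟫ ^ (m + 2) * ((p - 1) ^ m * ∏ i, |x i| ^ (p - 2)) := by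
  have hp1 : 1 < p := by linarith
  obtain ⟨L, f, τ, ε, hτ, hε, hL, hfC, h0, hf0, hgraph, rfl⟩ := hk
  change Euc m →ₗᵢ[ℝ] Euc (m + 1) at L
  change Euc m → ℝ at f
  have hf : ContDiffAt ℝ 2 f 0 := hfC.contDiffAt (ball_mem_nhds 0 hτ)
  have hsub : {y | ∃ v ∈ ball (0 : Euc m) τ, y = x + L v - f v • ν} ∩ ball x ε ⊆
      frontier (lpBall (m + 1) p) := fun y hy => (hgraph.symm.subset hy).1
  set a : Fin (m + 1) → ℝ := fun i => ⟪x, ν⟫ * ((p - 1) * |x i| ^ (p - 2)) with ha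
  have hQ := fderiv_fderiv_graph_lpBall hp hx hν hτ hε hL hf h0 hf0 hsub
  have hsymm : IsSymmSndFDerivAt ℝ f 0 :=
    hf.isSymmSndFDerivAt (by rw [minSmoothness_of_isRCLikeNormedField])
  have hB : ∀ e e', fderiv ℝ (fderiv ℝ f) 0 e e' = ∑ i, a i * (L e i * L e' i) := by
    intro e e'
    have h1 := hQ (e + e')
    simp only [map_add, add_apply, hQ e, hQ e', hsymm.eq e' e, PiLp.add_apply] at h1
    have h2 : ∑ i, a i * ((L e i + L e' i) * (L e i + L e' i)) = ∑ i, a i * (L e i * L e i)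
        + ∑ i, a i * (L e' i * L e' i) + 2 * ∑ i, a i * (L e i * L e' i) := by
      rw [Finset.mul_sum, ← Finset.sum_add_distrib, ← Finset.sum_add_distrib]
      exact Finset.sum_congr rfl fun i _ => by ring
    linarith
  have hmat : (Matrix.of fun i j : Fin m => iteratedFDeriv ℝ 2 f 0
      ![EuclideanSpace.single i 1, EuclideanSpace.single j 1])
      = Matrix.of fun i j : Fin m => ∑ k, a k * (L (EuclideanSpace.single i 1) k *
        L (EuclideanSpace.single j 1) k) := by
    ext i j
    rw [Matrix.of_apply, Matrix.of_apply, iteratedFDeriv_two_apply, ← hB]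
    rfl
  refine (congrArg Matrix.det hmat).trans ?_
  rw [det_transpose_mul_diagonal_mul L hν.1 hL a]
  have hterm : ∀ i, ν i ^ 2 * ∏ j ∈ Finset.univ.erase i, a j
      = ⟪x, ν⟫ ^ (m + 2) * ((p - 1) ^ m * ∏ i, |x i| ^ (p - 2)) * |x i| ^ p := by
    intro i
    have h1 : ν i = ⟪x, ν⟫ * dualityMap p x i :=
      congrArg (fun y : Euc (m + 1) => y i) (hν.eq_smul_dualityMap hp1 hx).2
    rw [h1, mul_pow, dualityMap_sq hp1, ← Finset.mul_prod_erase Finset.univ _ (Finset.mem_univ i)]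
    simp only [ha, Finset.prod_mul_distrib, Finset.prod_const]
    rw [Finset.card_erase_of_mem (Finset.mem_univ i), Finset.card_univ, Fintype.card_fin,
      Nat.add_sub_cancel]
    ring
  rw [Finset.sum_congr rfl fun i _ => hterm i, ← Finset.mul_sum, hx, mul_one]

end Hessian

section GaussFunction

lemma cConst_lpBall_pos (n : ℕ) {p : ℝ} (hp : 0 < p) : 0 < cConst n (lpBall n p) := by
  have h1 := volume_lpBall_toReal_pos n hp
  have h2 := ballVol_pos (n - 1)
  unfold cConst
  positivity

/-- The function `G` of the `ℓ_p` ball. -/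
lemma Gfun_lpBall {m : ℕ} {p : ℝ} (hp : 2 < p) {u : Euc (m + 1) → Euc (m + 1)}
    {κ : Euc (m + 1) → ℝ} (hC2 : IsC2Body (lpBall (m + 1) p) u κ) {x : Euc (m + 1)}
    (hx : ∑ i, |x i| ^ p = 1) :
    Gfun (lpBall (m + 1) p) u κ x = cConst (m + 1) (lpBall (m + 1) p) *
      ((p - 1) ^ m * ∏ i, |x i| ^ (p - 2)) ^ ((1 : ℝ) / (((m + 1 : ℕ) : ℝ) + 1)) := by
  have hfr : x ∈ frontier (lpBall (m + 1) p) := by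
    rw [frontier_lpBall _ (by linarith)]; exact hx
  obtain ⟨hu, hκ⟩ := hC2 x hfr
  have hpos := (hu.eq_smul_dualityMap (by linarith) hx).1
  have hP : 0 ≤ (p - 1) ^ m * ∏ i, |x i| ^ (p - 2) := by
    have : 0 ≤ p - 1 := by linarith
    have := Finset.prod_nonneg fun i (_ : i ∈ Finset.univ) => Real.rpow_nonneg (abs_nonneg (x i)) (p - 2)
    positivity
  have hroot : (⟪x, u x⟫ ^ (m + 2)) ^ ((1 : ℝ) / (((m + 1 : ℕ) : ℝ) + 1)) = ⟪x, u x⟫ := by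
    rw [← Real.rpow_natCast, ← Real.rpow_mul hpos.le]
    have : ((m + 2 : ℕ) : ℝ) * (1 / (((m + 1 : ℕ) : ℝ) + 1)) = 1 := by
      push_cast
      field_simp
      ring
    rw [this, Real.rpow_one]
  rw [Gfun, hκ.lpBall_eq hp hx hu, Real.mul_rpow (by positivity) hP, hroot]
  field_simp

lemma Gfun_lpBall_le_diagPoint {m : ℕ} {p : ℝ} (hp : 2 < p) {u : Euc (m + 1) → Euc (m + 1)}
    {κ : Euc (m + 1) → ℝ} (hC2 : IsC2Body (lpBall (m + 1) p) u κ) {x : Euc (m + 1)}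
    (hx : ∑ i, |x i| ^ p = 1) :
    Gfun (lpBall (m + 1) p) u κ x ≤ Gfun (lpBall (m + 1) p) u κ (diagPoint (m + 1) p) := by
  have hA : ∀ i, 0 ≤ |x i| ^ (p - 2) := fun i => Real.rpow_nonneg (abs_nonneg (x i)) _
  have hp1 : 0 ≤ p - 1 := by linarith
  have hd0 : 0 ≤ ((m + 1 : ℕ) : ℝ) ^ (-(1 : ℝ) / p) := by positivity
  have hle : ∏ i, |x i| ^ (p - 2) ≤ ∏ i, |diagPoint (m + 1) p i| ^ (p - 2) := by
    simp only [diagPoint_apply, abs_of_nonneg hd0, Finset.prod_const, Finset.card_univ,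
      Fintype.card_fin]
    refine (prod_le_mean_pow m.succ_pos hA).trans ?_
    exact pow_le_pow_left₀ (div_nonneg (Finset.sum_nonneg fun i _ => hA i) (Nat.cast_nonneg _))
      (sum_abs_rpow_sub_two_le m.succ_pos hp hx) _
  rw [Gfun_lpBall hp hC2 hx, Gfun_lpBall hp hC2 (sum_abs_diagPoint m.succ_pos (by linarith))]
  refine mul_le_mul_of_nonneg_left ?_ (cConst_lpBall_pos _ (by linarith)).le
  refine Real.rpow_le_rpow (mul_nonneg (by positivity) (Finset.prod_nonneg fun i _ => hA i)) ?_
    (by positivity)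
  exact mul_le_mul_of_nonneg_left hle (by positivity)

lemma Gfun_lpBall_diagPoint {m : ℕ} {p : ℝ} (hp : 2 < p) {u : Euc (m + 1) → Euc (m + 1)}
    {κ : Euc (m + 1) → ℝ} (hC2 : IsC2Body (lpBall (m + 1) p) u κ) :
    Gfun (lpBall (m + 1) p) u κ (diagPoint (m + 1) p) = cConst (m + 1) (lpBall (m + 1) p) *
      (diagWeight (m + 1) p ^ (m + 1) / (p - 1)) ^ ((1 : ℝ) / (((m + 1 : ℕ) : ℝ) + 1)) := by
  have hd0 : 0 ≤ ((m + 1 : ℕ) : ℝ) ^ (-(1 : ℝ) / p) := by positivity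
  have hp1 : p - 1 ≠ 0 := by linarith
  rw [Gfun_lpBall hp hC2 (sum_abs_diagPoint m.succ_pos (by linarith))]
  congr 2
  simp only [diagPoint_apply, abs_of_nonneg hd0, Finset.prod_const, Finset.card_univ,
    Fintype.card_fin, diagWeight, mul_pow]
  rw [pow_succ (p - 1) m]
  field_simp

lemma capConst_mul_cConst_rpow (m : ℕ) {p W : ℝ} (hp : 0 < p) (hW : 0 < W) :
    capConst m * (cConst (m + 1) (lpBall (m + 1) p) *
      W ^ ((1 : ℝ) / (((m + 1 : ℕ) : ℝ) + 1))) ^ ((m : ℝ) / 2 + 1)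
      = (volume (lpBall (m + 1) p)).toReal * √W := by
  have hV := volume_lpBall_toReal_pos (m + 1) hp
  have hB := ballVol_pos m
  have hc := cConst_lpBall_pos (m + 1) hp
  have e1 : (1 : ℝ) / (((m + 1 : ℕ) : ℝ) + 1) * ((m : ℝ) / 2 + 1) = 1 / 2 := by
    push_cast; field_simp; ring
  have e2 : (2 : ℝ) / (((m + 1 : ℕ) : ℝ) + 1) * ((m : ℝ) / 2 + 1) = 1 := by
    push_cast; field_simp; ring
  have hcpow : cConst (m + 1) (lpBall (m + 1) p) ^ ((m : ℝ) / 2 + 1)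
      = (((m + 1 : ℕ) : ℝ) + 1) / 2 ^ ((m : ℝ) / 2 + 1) *
        ((volume (lpBall (m + 1) p)).toReal / (volume (ball (0 : Euc m) 1)).toReal) := by
    change ((((m + 1 : ℕ) : ℝ) + 1) ^ ((2 : ℝ) / (((m + 1 : ℕ) : ℝ) + 1)) / 2 *
      ((volume (lpBall (m + 1) p)).toReal / (volume (ball (0 : Euc m) 1)).toReal) ^
        ((2 : ℝ) / (((m + 1 : ℕ) : ℝ) + 1))) ^ ((m : ℝ) / 2 + 1) = _
    rw [Real.mul_rpow (by positivity) (by positivity), Real.div_rpow (by positivity) (by positivity),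
      ← Real.rpow_mul (by positivity), ← Real.rpow_mul (by positivity), e2, Real.rpow_one,
      Real.rpow_one]
  rw [Real.mul_rpow hc.le (by positivity), ← Real.rpow_mul hW.le, e1, ← Real.sqrt_eq_rpow, hcpow,
    capConst, Real.rpow_add two_pos, Real.rpow_one]
  push_cast
  field_simp
  ring

lemma Gfun_lpBall_nonneg {m : ℕ} {p : ℝ} (hp : 2 < p) {u : Euc (m + 1) → Euc (m + 1)}
    {κ : Euc (m + 1) → ℝ} (hC2 : IsC2Body (lpBall (m + 1) p) u κ) {x : Euc (m + 1)}
    (hx : ∑ i, |x i| ^ p = 1) : 0 ≤ Gfun (lpBall (m + 1) p) u κ x := by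
  rw [Gfun_lpBall hp hC2 hx]
  have hp1 : 0 ≤ p - 1 := by linarith
  exact mul_nonneg (cConst_lpBall_pos _ (by linarith)).le (Real.rpow_nonneg (mul_nonneg
    (by positivity) (Finset.prod_nonneg fun i _ => Real.rpow_nonneg (abs_nonneg (x i)) _)) _)

lemma sum_abs_single_rpow {n : ℕ} {p : ℝ} (hp : p ≠ 0) (j : Fin n) :
    ∑ i, |(EuclideanSpace.single j (1 : ℝ) : Euc n) i| ^ p = 1 := by
  rw [Finset.sum_eq_single j]
  · simp
  · intro i _ hi
    simp [hi, hp]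
  · simp

lemma Gfun_lpBall_single {m : ℕ} (hm : m ≠ 0) {p : ℝ} (hp : 2 < p)
    {u : Euc (m + 1) → Euc (m + 1)} {κ : Euc (m + 1) → ℝ}
    (hC2 : IsC2Body (lpBall (m + 1) p) u κ) :
    Gfun (lpBall (m + 1) p) u κ (EuclideanSpace.single 0 1) = 0 := by
  rw [Gfun_lpBall hp hC2 (sum_abs_single_rpow (by linarith) 0)]
  have h0 : (Fin.last m) ≠ 0 := by
    rw [Ne, Fin.ext_iff]; simpa using hm
  have h1 : ∏ i, |(EuclideanSpace.single 0 (1 : ℝ) : Euc (m + 1)) i| ^ (p - 2) = 0 := by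
    refine Finset.prod_eq_zero (Finset.mem_univ (Fin.last m)) ?_
    have : p - 2 ≠ 0 := by linarith
    simp [h0, this]
  rw [h1, mul_zero, Real.zero_rpow (by positivity), mul_zero]

end GaussFunction

/-- Theorem 4.3: for `n ≥ 2` and `2 < p < ∞`,
`lim_{δ→0} (d_p(δ) − 1)/δ^{2/(n+1)} = G((n^{−1/p},…,n^{−1/p})) = G_max`, and `G_min = 0`. -/
theorem statement2 {n : ℕ} (hn : 2 ≤ n) (p : ℝ) (hp : 2 < p)
    (u : Euc n → Euc n) (κ : Euc n → ℝ)
    (hC2 : IsC2Body (lpBall n p) u κ) :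
    Tendsto (fun δ : ℝ => (dualDist (lpBall n p) δ - 1) / δ ^ ((2:ℝ)/(n+1)))
        (𝓝[>] 0)
        (𝓝 (Gfun (lpBall n p) u κ
          ((EuclideanSpace.equiv (Fin n) ℝ).symm fun _ => (n:ℝ) ^ (-(1:ℝ)/p)))) ∧
      Gfun (lpBall n p) u κ ((EuclideanSpace.equiv (Fin n) ℝ).symm fun _ => (n:ℝ) ^ (-(1:ℝ)/p))
        = sSup (Gfun (lpBall n p) u κ '' frontier (lpBall n p)) ∧
      sInf (Gfun (lpBall n p) u κ '' frontier (lpBall n p)) = 0 := by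
  obtain ⟨m, rfl⟩ : ∃ m, n = m + 1 := ⟨n - 1, by omega⟩
  have hm : m ≠ 0 := by omega
  have hp0 : 0 < p := by linarith
  have hdiag : ((EuclideanSpace.equiv (Fin (m + 1)) ℝ).symm
      fun _ => ((m + 1 : ℕ) : ℝ) ^ (-(1:ℝ)/p)) = diagPoint (m + 1) p := rfl
  have hfr : ∀ x : Euc (m + 1), x ∈ frontier (lpBall (m + 1) p) ↔ ∑ i, |x i| ^ p = 1 := by
    intro x
    rw [frontier_lpBall _ hp0, mem_ofPred_eq]
  have hdmem : diagPoint (m + 1) p ∈ frontier (lpBall (m + 1) p) :=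
    (hfr _).2 (sum_abs_diagPoint m.succ_pos hp0)
  rw [hdiag]
  refine ⟨?_, ?_, ?_⟩
  · have hW : 0 < diagWeight (m + 1) p ^ (m + 1) / (p - 1) :=
      div_pos (pow_pos (diagWeight_pos m.succ_pos (by linarith)) _) (by linarith)
    rw [Gfun_lpBall_diagPoint hp hC2]
    exact tendsto_dualDist_lpBall hm hp
      (mul_pos (cConst_lpBall_pos _ hp0) (Real.rpow_pos_of_pos hW _))
      (capConst_mul_cConst_rpow m hp0 hW)
  · refine (IsGreatest.csSup_eq ⟨mem_image_of_mem _ hdmem, ?_⟩).symm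
    rintro _ ⟨x, hx, rfl⟩
    exact Gfun_lpBall_le_diagPoint hp hC2 ((hfr x).1 hx)
  · refine IsLeast.csInf_eq ⟨⟨EuclideanSpace.single 0 1, (hfr _).2 (sum_abs_single_rpow hp0.ne' 0),
      Gfun_lpBall_single hm hp hC2⟩, ?_⟩
    rintro _ ⟨x, hx, rfl⟩
    exact Gfun_lpBall_nonneg hp hC2 ((hfr x).1 hx)
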